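/- arXiv:2205.05736 — 3 statements merged into one kernel-verified Lean document; each statement's English description precedes it below -/
import Mathlib

section
/- Let p_γ be the wrapped normal density on [-π, π] with parameter γ > 0, and let h(p_γ) = −∫_{-π}^{π} p_γ(φ) log₂ p_γ(φ) dφ be its differential entropy. Then in the small-dephasing limit, lim_{γ → 0⁺} [ h(p_γ) − (1/2) log₂(2π e γ) ] = 0; equivalently, D(p_γ‖u) − (1/2) log₂( 2π / (e γ) ) → 0 as γ → 0⁺, where u is the uniform density on [-π, π]. -/
open scoped Real
open MeasureTheory Filter

/-- The sum of the translates by multiples of `L` of the Gaussian `x ↦ exp (-x² / 2)`. -/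
noncomputable def periodizedGaussian (L x : ℝ) : ℝ :=
  ∑' k : ℤ, Real.exp (-(x + L * k) ^ 2 / 2)

lemma summable_exp_one_sub_abs : Summable fun k : ℤ => Real.exp (1 - |(k : ℝ)|) := by
  have h : Summable fun n : ℕ => Real.exp (1 - |((n : ℤ) : ℝ)|) := by
    simpa [sub_eq_add_neg, Real.exp_add] using Real.summable_exp_neg_nat.mul_left (Real.exp 1)
  exact Summable.of_nat_of_neg h (by simpa using h)

lemma exp_translate_le {L x : ℝ} (hL : 2 ≤ L) (hx : |x| ≤ L / 2) (k : ℤ) :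
    Real.exp (-(x + L * k) ^ 2 / 2) ≤
      Real.exp (-x ^ 2 / 2) * Real.exp (1 - |(k : ℝ)|) := by
  rw [← Real.exp_add, Real.exp_le_exp]
  have hk : |(k : ℝ)| ≤ |(k : ℝ)| ^ 2 := by
    rcases eq_or_ne k 0 with rfl | h
    · simp
    · have : (1 : ℝ) ≤ |(k : ℝ)| := by exact_mod_cast Int.one_le_abs h
      nlinarith
  have h1 : -(L / 2 * |(k : ℝ)|) ≤ x * k := by
    have := neg_abs_le (x * (k : ℝ))
    rw [abs_mul] at this
    nlinarith [abs_nonneg (k : ℝ)]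
  have h2 : 4 * (|(k : ℝ)| ^ 2 - |(k : ℝ)|) ≤ L ^ 2 * (|(k : ℝ)| ^ 2 - |(k : ℝ)|) :=
    mul_le_mul_of_nonneg_right (by nlinarith) (by linarith)
  have h3 := sq_abs (k : ℝ)
  have h4 := mul_le_mul_of_nonneg_left h1 (by linarith : 0 ≤ L)
  nlinarith [sq_nonneg (|(k : ℝ)| - 1)]

lemma summable_exp_translate {L x : ℝ} (hL : 2 ≤ L) (hx : |x| ≤ L / 2) :
    Summable fun k : ℤ => Real.exp (-(x + L * k) ^ 2 / 2) :=
  .of_nonneg_of_le (fun _ => (Real.exp_pos _).le) (exp_translate_le hL hx)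
    (summable_exp_one_sub_abs.mul_left _)

lemma exp_le_periodizedGaussian {L x : ℝ} (hL : 2 ≤ L) (hx : |x| ≤ L / 2) :
    Real.exp (-x ^ 2 / 2) ≤ periodizedGaussian L x := by
  simpa [periodizedGaussian] using (summable_exp_translate hL hx).le_tsum 0 fun _ _ => (Real.exp_pos _).le

lemma periodizedGaussian_le {L x : ℝ} (hL : 2 ≤ L) (hx : |x| ≤ L / 2) :
    periodizedGaussian L x ≤
      Real.exp (-x ^ 2 / 2) * ∑' k : ℤ, Real.exp (1 - |(k : ℝ)|) := by
  rw [← tsum_mul_left]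
  exact (summable_exp_translate hL hx).tsum_le_tsum (exp_translate_le hL hx)
    (summable_exp_one_sub_abs.mul_left _)

lemma periodizedGaussian_pos {L x : ℝ} (hL : 2 ≤ L) (hx : |x| ≤ L / 2) :
    0 < periodizedGaussian L x :=
  (Real.exp_pos _).trans_le (exp_le_periodizedGaussian hL hx)

lemma continuousOn_periodizedGaussian {L : ℝ} (hL : 2 ≤ L) :
    ContinuousOn (periodizedGaussian L) (Set.Icc (-(L / 2)) (L / 2)) := by
  refine continuousOn_tsum (fun k => by fun_prop) summable_exp_one_sub_abs fun k x hx => ?_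
  rw [Real.norm_of_nonneg (Real.exp_pos _).le]
  refine (exp_translate_le hL (abs_le.2 hx) k).trans
    (mul_le_of_le_one_left (Real.exp_pos _).le (Real.exp_le_one_iff.2 ?_))
  nlinarith [sq_nonneg x]

lemma tendsto_periodizedGaussian (x : ℝ) :
    Tendsto (fun L => periodizedGaussian L x) atTop (nhds (Real.exp (-x ^ 2 / 2))) := by
  have h0 : Real.exp (-x ^ 2 / 2) = ∑' k : ℤ, if k = 0 then Real.exp (-x ^ 2 / 2) else 0 := by
    simp
  rw [h0]
  refine tendsto_tsum_of_dominated_convergence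
    (summable_exp_one_sub_abs.mul_left (Real.exp (-x ^ 2 / 2))) (fun k => ?_) ?_
  · split_ifs with hk
    · simp [hk]
    · have hk' : (1 : ℝ) ≤ (k : ℝ) ^ 2 := by
        have : 1 ≤ |(k : ℝ)| := by exact_mod_cast Int.one_le_abs hk
        rw [← sq_abs]; nlinarith
      have h1 : Tendsto (fun L : ℝ => L * k + x) atTop (Bornology.cobounded ℝ) := by
        rcases lt_or_gt_of_ne hk with h | h
        · exact (tendsto_atBot_add_const_right _ x
            (tendsto_id.atTop_mul_const_of_neg (by exact_mod_cast h))).mono_right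
            IsOrderBornology.atBot_le_cobounded
        · exact (tendsto_atTop_add_const_right _ x
            (tendsto_id.atTop_mul_const (by exact_mod_cast h))).mono_right
            IsOrderBornology.atTop_le_cobounded
      have h2 := (tendsto_pow_atTop two_ne_zero).comp (tendsto_norm_cobounded_atTop.comp h1)
      refine Real.tendsto_exp_atBot.comp ?_
      refine ((tendsto_neg_atTop_atBot.comp h2).atBot_div_const two_pos).congr fun L => ?_
      simp [add_comm]
  · filter_upwards [eventually_ge_atTop 2, eventually_ge_atTop (2 * |x|)] with L hL hx k
    rw [Real.norm_of_nonneg (Real.exp_pos _).le]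
    exact exp_translate_le hL (by linarith) k

lemma integrable_exp_neg_sq_div_two : Integrable fun x : ℝ => Real.exp (-x ^ 2 / 2) := by
  refine (integrable_exp_neg_mul_sq (b := 1 / 2) (by norm_num)).congr (.of_forall fun x => ?_)
  simp only; congr 1; ring

lemma integral_exp_neg_sq_div_two : ∫ x : ℝ, Real.exp (-x ^ 2 / 2) = √(2 * π) := by
  rw [show 2 * π = π / (1 / 2) by ring, ← integral_gaussian]
  congr 1 with x; congr 1; ring

lemma integrable_sq_mul_exp_neg_sq_div_two :
    Integrable fun x : ℝ => x ^ 2 * Real.exp (-x ^ 2 / 2) := by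
  refine (integrable_rpow_mul_exp_neg_mul_sq (b := 1 / 2) (by norm_num)
    (s := 2) (by norm_num)).congr (.of_forall fun x => ?_)
  simp only [Real.rpow_two]; congr 2; ring

lemma integral_sq_mul_exp_neg_sq_div_two :
    ∫ x : ℝ, x ^ 2 * Real.exp (-x ^ 2 / 2) = √(2 * π) := by
  have hd (x : ℝ) : HasDerivAt (fun x : ℝ => x * Real.exp (-x ^ 2 / 2))
      (Real.exp (-x ^ 2 / 2) - x ^ 2 * Real.exp (-x ^ 2 / 2)) x := by
    have h1 : HasDerivAt (fun x : ℝ => -x ^ 2 / 2) (-x) x := by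
      refine ((hasDerivAt_pow 2 x).neg.div_const 2).congr_deriv ?_
      push_cast; ring
    refine ((hasDerivAt_id x).mul h1.exp).congr_deriv ?_
    simp only [id]; ring
  have hi : Integrable fun x : ℝ => x * Real.exp (-x ^ 2 / 2) := by
    refine (integrable_mul_exp_neg_mul_sq (b := 1 / 2) (by norm_num)).congr
      (.of_forall fun x => ?_)
    simp only; congr 2; ring
  have := integral_eq_zero_of_hasDerivAt_of_integrable hd
    (integrable_exp_neg_sq_div_two.sub integrable_sq_mul_exp_neg_sq_div_two) hi
  rw [integral_sub integrable_exp_neg_sq_div_two integrable_sq_mul_exp_neg_sq_div_two,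
    integral_exp_neg_sq_div_two] at this
  linarith

lemma integral_periodizedGaussian {L : ℝ} (hL : 2 ≤ L) :
    ∫ x in (-(L / 2))..(L / 2), periodizedGaussian L x = √(2 * π) := by
  have hL0 : 0 < L := by linarith
  have h1 : HasSum (fun k : ℤ => ∫ x in (-(L / 2))..(L / 2), Real.exp (-(x + L * k) ^ 2 / 2))
      (∫ x in (-(L / 2))..(L / 2), periodizedGaussian L x) := by
    refine intervalIntegral.hasSum_integral_of_dominated_convergence
      (fun k _ => Real.exp (1 - |(k : ℝ)|)) (fun k => ?_) (fun k => .of_forall fun x hx => ?_)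
      (.of_forall fun _ _ => summable_exp_one_sub_abs) (by simp) (.of_forall fun x hx => ?_)
    · exact Continuous.aestronglyMeasurable (by fun_prop)
    · rw [Set.uIoc_of_le (by linarith)] at hx
      rw [Real.norm_of_nonneg (Real.exp_pos _).le]
      refine (exp_translate_le hL (abs_le.2 ⟨hx.1.le, hx.2⟩) k).trans
        (mul_le_of_le_one_left (Real.exp_pos _).le (Real.exp_le_one_iff.2 ?_))
      nlinarith [sq_nonneg x]
    · rw [Set.uIoc_of_le (by linarith)] at hx
      exact (summable_exp_translate hL (abs_le.2 ⟨hx.1.le, hx.2⟩)).hasSum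
  have h2 : HasSum (fun k : ℤ => ∫ x in (-(L / 2))..(L / 2), Real.exp (-(x + L * k) ^ 2 / 2))
      (∫ x : ℝ, Real.exp (-x ^ 2 / 2)) := by
    have := hasSum_integral_iUnion (μ := volume) (f := fun x : ℝ => Real.exp (-x ^ 2 / 2))
      (fun k : ℤ => measurableSet_Ioc) (Set.pairwise_disjoint_Ioc_add_zsmul (-(L / 2)) L)
      integrable_exp_neg_sq_div_two.integrableOn
    rw [iUnion_Ioc_add_zsmul hL0, setIntegral_univ] at this
    refine (congrArg (HasSum · _) (funext fun k => ?_)).mp this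
    rw [intervalIntegral.integral_comp_add_right (f := fun x : ℝ => Real.exp (-x ^ 2 / 2)),
      intervalIntegral.integral_of_le (by linarith)]
    congr 3 <;> simp only [zsmul_eq_mul, Int.cast_add, Int.cast_one] <;> ring
  rw [h1.unique h2, integral_exp_neg_sq_div_two]

lemma abs_periodizedGaussian_mul_log_le {L x : ℝ} (hL : 2 ≤ L) (hx : |x| ≤ L / 2) :
    |periodizedGaussian L x * Real.log (periodizedGaussian L x)| ≤
      (∑' k : ℤ, Real.exp (1 - |(k : ℝ)|)) *
        (Real.log (∑' k : ℤ, Real.exp (1 - |(k : ℝ)|)) * Real.exp (-x ^ 2 / 2) +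
          x ^ 2 * Real.exp (-x ^ 2 / 2)) := by
  set C := ∑' k : ℤ, Real.exp (1 - |(k : ℝ)|)
  have hW := periodizedGaussian_pos hL hx
  have hlo := exp_le_periodizedGaussian hL hx
  have hhi := periodizedGaussian_le hL hx
  have hE := Real.exp_pos (-x ^ 2 / 2)
  have hC : 1 ≤ C := by
    by_contra! h
    nlinarith
  have hlog1 := Real.log_le_log hE hlo
  have hlog2 := Real.log_le_log hW hhi
  rw [Real.log_mul hE.ne' (by linarith)] at hlog2
  rw [Real.log_exp] at hlog1 hlog2
  have hlogC := Real.log_nonneg hC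
  have habs : |Real.log (periodizedGaussian L x)| ≤ Real.log C + x ^ 2 :=
    abs_le.2 ⟨by nlinarith [sq_nonneg x], by nlinarith [sq_nonneg x]⟩
  rw [abs_mul, abs_of_pos hW]
  calc _ ≤ (Real.exp (-x ^ 2 / 2) * C) * (Real.log C + x ^ 2) := by gcongr
    _ = _ := by ring

lemma tendsto_integral_periodizedGaussian_mul_log :
    Tendsto (fun L => ∫ x in (-(L / 2))..(L / 2),
        periodizedGaussian L x * Real.log (periodizedGaussian L x))
      atTop (nhds (-(√(2 * π) / 2))) := by
  have hlim : -(√(2 * π) / 2) =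
      ∫ x : ℝ, Real.exp (-x ^ 2 / 2) * Real.log (Real.exp (-x ^ 2 / 2)) := by
    rw [← integral_sq_mul_exp_neg_sq_div_two, ← integral_div, ← integral_neg]
    congr 1 with x
    rw [Real.log_exp]; ring
  have hcongr : (fun L => ∫ x, (Set.Ioc (-(L / 2)) (L / 2)).indicator
      (fun x => periodizedGaussian L x * Real.log (periodizedGaussian L x)) x) =ᶠ[atTop]
      fun L => ∫ x in (-(L / 2))..(L / 2),
        periodizedGaussian L x * Real.log (periodizedGaussian L x) := by
    filter_upwards [eventually_ge_atTop 2] with L hL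
    rw [integral_indicator measurableSet_Ioc, intervalIntegral.integral_of_le (by linarith)]
  rw [hlim]
  refine Tendsto.congr' hcongr ?_
  set C := ∑' k : ℤ, Real.exp (1 - |(k : ℝ)|)
  refine tendsto_integral_filter_of_dominated_convergence
    (fun x => |C * (Real.log C * Real.exp (-x ^ 2 / 2) + x ^ 2 * Real.exp (-x ^ 2 / 2))|)
    ?_ ?_ ?_ (.of_forall fun x => ?_)
  · filter_upwards [eventually_ge_atTop 2] with L hL
    have hc := continuousOn_periodizedGaussian hL
    rw [aestronglyMeasurable_indicator_iff measurableSet_Ioc]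
    refine ((hc.mul (hc.log fun x hx => ?_)).mono
      Set.Ioc_subset_Icc_self).aestronglyMeasurable measurableSet_Ioc
    exact (periodizedGaussian_pos hL (abs_le.2 hx)).ne'
  · filter_upwards [eventually_ge_atTop 2] with L hL
    refine .of_forall fun x => ?_
    by_cases hx : x ∈ Set.Ioc (-(L / 2)) (L / 2)
    · rw [Set.indicator_of_mem hx, Real.norm_eq_abs]
      exact (abs_periodizedGaussian_mul_log_le hL (abs_le.2 ⟨hx.1.le, hx.2⟩)).trans
        (le_abs_self _)
    · rw [Set.indicator_of_notMem hx, norm_zero]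
      exact abs_nonneg _
  · exact (((integrable_exp_neg_sq_div_two.const_mul _).add
      integrable_sq_mul_exp_neg_sq_div_two).const_mul _).abs
  · have h := (tendsto_periodizedGaussian x).mul
      ((tendsto_periodizedGaussian x).log (Real.exp_pos _).ne')
    refine h.congr' ?_
    filter_upwards [eventually_gt_atTop (2 * |x|)] with L hL
    rw [Set.indicator_of_mem]
    exact ⟨by linarith [neg_abs_le x], by linarith [le_abs_self x]⟩

/-- The entropy of the wrapped normal density, rescaled to unit variance. -/
lemma wrapped_normal_entropy_sub_eq {γ : ℝ} (hγ : 0 < γ) (hL : 2 ≤ 2 * π / √γ) (q : ℝ → ℝ)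
    (hq : ∀ φ, q φ =
      (1 / √(2 * π * γ)) * ∑' k : ℤ, Real.exp (-(φ + 2 * π * k) ^ 2 / (2 * γ))) :
    (-∫ φ in (-π)..π, q φ * Real.logb 2 (q φ)) -
        (1 / 2) * Real.logb 2 (2 * π * Real.exp 1 * γ) =
      -(1 / √(2 * π) * (∫ x in (-((2 * π / √γ) / 2))..((2 * π / √γ) / 2),
        periodizedGaussian (2 * π / √γ) x * Real.log (periodizedGaussian (2 * π / √γ) x))
          + 1 / 2) / Real.log 2 := by
  have hs : 0 < √γ := Real.sqrt_pos.2 hγ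
  have hss : √γ ^ 2 = γ := Real.sq_sqrt hγ.le
  have hr : 0 < √(2 * π) := Real.sqrt_pos.2 (by positivity)
  have hrs : √(2 * π * γ) = √(2 * π) * √γ := Real.sqrt_mul (by positivity) _
  set L := 2 * π / √γ with hLdef
  have hLs : √γ * (L / 2) = π := by rw [hLdef]; field_simp
  have hqW (x : ℝ) : q (√γ * x) = 1 / (√(2 * π) * √γ) * periodizedGaussian L x := by
    rw [hq, hrs, periodizedGaussian]
    congr 2 with k
    congr 1
    rw [hLdef]
    nth_rewrite 2 [← hss]
    field_simp
  set W := periodizedGaussian L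
  have hsub : ∫ φ in (-π)..π, q φ * Real.logb 2 (q φ) =
      √γ * ∫ x in (-(L / 2))..(L / 2), q (√γ * x) * Real.logb 2 (q (√γ * x)) := by
    rw [intervalIntegral.mul_integral_comp_mul_left (f := fun φ => q φ * Real.logb 2 (q φ)),
      mul_neg, hLs]
  have hu : Set.uIcc (-(L / 2)) (L / 2) = Set.Icc (-(L / 2)) (L / 2) :=
    Set.uIcc_of_le (by linarith)
  have hcW : ContinuousOn W (Set.uIcc (-(L / 2)) (L / 2)) :=
    hu ▸ continuousOn_periodizedGaussian hL
  have hpos (x : ℝ) (hx : x ∈ Set.uIcc (-(L / 2)) (L / 2)) : 0 < W x :=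
    periodizedGaussian_pos hL (abs_le.2 (Set.mem_Icc.1 (hu ▸ hx)))
  have hcWl : ContinuousOn (fun x => W x * Real.log (W x)) (Set.uIcc (-(L / 2)) (L / 2)) :=
    hcW.mul (hcW.log fun x hx => (hpos x hx).ne')
  have hint : ∫ x in (-(L / 2))..(L / 2), q (√γ * x) * Real.logb 2 (q (√γ * x)) =
      ∫ x in (-(L / 2))..(L / 2), 1 / (√(2 * π) * √γ * Real.log 2) *
        (W x * Real.log (W x) - Real.log (√(2 * π) * √γ) * W x) := by
    refine intervalIntegral.integral_congr fun x hx => ?_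
    simp only [hqW]
    rw [Real.logb, Real.log_mul (by positivity) (hpos x hx).ne', one_div, Real.log_inv]
    field_simp
    ring
  have hlog : Real.log (2 * π * Real.exp 1 * γ) = 2 * Real.log (√(2 * π) * √γ) + 1 := by
    rw [← hrs, Real.log_sqrt (by positivity), mul_right_comm,
      Real.log_mul (by positivity) (by positivity), Real.log_exp]
    ring
  rw [hsub, hint, intervalIntegral.integral_const_mul,
    intervalIntegral.integral_sub hcWl.intervalIntegrable
      (hcW.intervalIntegrable.const_mul _), intervalIntegral.integral_const_mul,
    integral_periodizedGaussian hL, Real.logb, hlog]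
  have : Real.log 2 ≠ 0 := by positivity
  field_simp
  ring

/-- small-dephasing limit. For the wrapped normal density `p_γ` on
`[-π, π]`, the differential entropy `h(p_γ)` approaches `(1/2) log₂(2πeγ)` as `γ → 0⁺`,
i.e. `h(p_γ) − (1/2) log₂(2πeγ) → 0`. -/
theorem wrapped_normal_entropy_small_dephasing
    (p : ℝ → ℝ → ℝ)
    (hp : ∀ γ : ℝ, 0 < γ → ∀ φ : ℝ, p γ φ =
      (1 / Real.sqrt (2 * π * γ)) * ∑' k : ℤ, Real.exp (-(φ + 2 * π * k) ^ 2 / (2 * γ))) :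
    Tendsto (fun γ : ℝ =>
        (-∫ φ in (-π)..π, p γ φ * Real.logb 2 (p γ φ)) -
          (1 / 2) * Real.logb 2 (2 * π * Real.exp 1 * γ))
      (nhdsWithin 0 (Set.Ioi 0)) (nhds 0) := by
  have hL : Tendsto (fun γ : ℝ => 2 * π / √γ) (nhdsWithin 0 (Set.Ioi 0)) atTop := by
    refine Tendsto.const_mul_atTop (by positivity) (tendsto_inv_nhdsGT_zero.comp ?_)
    refine tendsto_nhdsWithin_iff.2 ⟨?_, ?_⟩
    · simpa using (Real.continuous_sqrt.tendsto 0).mono_left nhdsWithin_le_nhds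
    · filter_upwards [self_mem_nhdsWithin] with γ hγ using Real.sqrt_pos.2 hγ
  have h := ((((tendsto_integral_periodizedGaussian_mul_log.comp hL).const_mul
    (1 / √(2 * π))).add_const (1 / 2)).neg).div_const (Real.log 2)
  have h0 : -(1 / √(2 * π) * -(√(2 * π) / 2) + 1 / 2) / Real.log 2 = 0 := by
    have : √(2 * π) ≠ 0 := by positivity
    field_simp
    simp
  rw [h0] at h
  refine h.congr' ?_
  filter_upwards [self_mem_nhdsWithin, hL.eventually_ge_atTop 2] with γ hγ hγL
  exact (wrapped_normal_entropy_sub_eq hγ hγL (p γ) (hp γ hγ)).symm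
end

section
/- Let p_γ be the wrapped normal density on [-π, π] with parameter γ > 0 and let D(p_γ‖u) be its Kullback–Leibler divergence from the uniform density u ≡ 1/(2π). Then in the large-dephasing limit, D(p_γ‖u) = (2/ln 2) e^{-γ} − log₂(1 + e^{-γ}) + O(e^{-6γ}) = e^{-γ}/ln 2 + O(e^{-2γ}) as γ → ∞. -/
open scoped Real
open MeasureTheory

open Filter Asymptotics Topology

/-- Nome tending to `0` from the right, uniformly in the angle. -/
def nomeFilter : Filter (ℝ × ℝ) := 𝓝[>] (0 : ℝ) ×ˢ ⊤

lemma tendsto_fst_nomeFilter : Tendsto Prod.fst nomeFilter (𝓝 0) :=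
  tendsto_fst.mono_right nhdsWithin_le_nhds

lemma isBigO_one_of_continuous_cos {h : ℝ × ℝ → ℝ} (hh : Continuous h) :
    (fun q : ℝ × ℝ => h (q.1, Real.cos q.2)) =O[nomeFilter] (fun _ => (1 : ℝ)) := by
  obtain ⟨C, hC⟩ := (isCompact_Icc.prod isCompact_Icc :
    IsCompact (Set.Icc (0 : ℝ) 1 ×ˢ Set.Icc (-1 : ℝ) 1)).exists_bound_of_continuousOn
      hh.continuousOn
  refine IsBigO.of_bound C ?_
  have h1 : ∀ᶠ q in nomeFilter, q.1 ∈ Set.Ioo (0 : ℝ) 1 :=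
    tendsto_fst.eventually (Ioo_mem_nhdsGT one_pos)
  filter_upwards [h1] with q hq
  simpa using hC (q.1, Real.cos q.2)
    ⟨Set.Ioo_subset_Icc_self hq, Real.neg_one_le_cos _, Real.cos_le_one _⟩

lemma isBigO_pow_of_eq_mul {F : ℝ × ℝ → ℝ} {h : ℝ × ℝ → ℝ} (n : ℕ) (hh : Continuous h)
    (hF : ∀ q, F q = q.1 ^ n * h (q.1, Real.cos q.2)) :
    F =O[nomeFilter] (fun q => q.1 ^ n) := by
  have := (isBigO_refl (fun q : ℝ × ℝ => q.1 ^ n) nomeFilter).mul (isBigO_one_of_continuous_cos hh)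
  simpa [funext hF] using this

lemma isBigO_pow_pow_of_le {m n : ℕ} (h : m ≤ n) :
    (fun q : ℝ × ℝ => q.1 ^ n) =O[nomeFilter] (fun q => q.1 ^ m) :=
  isBigO_pow_of_eq_mul (h := fun q => q.1 ^ (n - m)) m (by fun_prop)
    (fun q => by rw [← pow_add, Nat.add_sub_cancel' h])

lemma tendsto_zero_of_isBigO_pow {F : ℝ × ℝ → ℝ} {n : ℕ} (hn : n ≠ 0)
    (hF : F =O[nomeFilter] (fun q => q.1 ^ n)) : Tendsto F nomeFilter (𝓝 0) :=
  hF.trans_tendsto (by simpa [hn] using tendsto_fst_nomeFilter.pow n)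

lemma isBigO_log_sub_log {α : Type*} {l : Filter α} {F G : α → ℝ}
    (hF : Tendsto F l (𝓝 1)) (hG : Tendsto G l (𝓝 1)) :
    (fun a => Real.log (F a) - Real.log (G a)) =O[l] (fun a => F a - G a) :=
  (Real.hasStrictDerivAt_log one_ne_zero).hasStrictFDerivAt.isBigO_sub.comp_tendsto
    (hF.prodMk_nhds hG)

/-- Taylor polynomial of `log (1 + y)` at `0`, with terms of degree less than `n`. -/
noncomputable def logTaylorReal (n : ℕ) (y : ℝ) : ℝ :=
  ∑ j ∈ Finset.range n, (-1) ^ (j + 1) * y ^ j / j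

lemma isBigO_log_one_add_sub_logTaylorReal (n : ℕ) :
    (fun y : ℝ => Real.log (1 + y) - logTaylorReal (n + 1) y) =O[𝓝 0] (fun y => y ^ (n + 1)) := by
  have h := (Complex.log_sub_logTaylor_isBigO n).comp_tendsto
    (Complex.continuous_ofReal.tendsto' 0 0 Complex.ofReal_zero)
  rw [← isBigO_norm_norm] at h ⊢
  refine h.congr' ?_ ?_
  · have : ∀ᶠ y : ℝ in 𝓝 0, 0 < 1 + y :=
      (continuous_const.add continuous_id).tendsto' (0 : ℝ) 1 (by simp) |>.eventually
        (lt_mem_nhds one_pos)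
    filter_upwards [this] with y hy
    rw [← Complex.norm_real]
    simp only [Function.comp, Complex.ofReal_sub, Complex.ofReal_log hy.le, logTaylorReal,
      Complex.logTaylor]
    push_cast
    rfl
  · exact .of_forall fun y => by simp

/-- Cosine polynomial approximating `log (1 + 2 a cos φ + a ^ 2)`, with terms of degree less
than `n` in `a`. -/
noncomputable def logCosTaylor (n : ℕ) (a φ : ℝ) : ℝ :=
  ∑ j ∈ Finset.range n, 2 * ((-1) ^ (j + 1) * a ^ j / j) * Real.cos (j * φ)

lemma log_one_add_two_mul_cos_eq (a φ : ℝ) :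
    Real.log (1 + 2 * a * Real.cos φ + a ^ 2) =
      2 * (Complex.log (1 + a * Complex.exp (φ * Complex.I))).re := by
  have h : Complex.normSq (1 + a * Complex.exp (φ * Complex.I)) =
      1 + 2 * a * Real.cos φ + a ^ 2 := by
    rw [Complex.exp_mul_I, Complex.normSq_apply]
    simp [Complex.cos_ofReal_re, Complex.sin_ofReal_re, Complex.cos_ofReal_im,
      Complex.sin_ofReal_im]
    linear_combination a ^ 2 * Real.sin_sq_add_cos_sq φ
  rw [Complex.log_re, ← h, Complex.normSq_eq_norm_sq, Real.log_pow]
  norm_num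

lemma logCosTaylor_eq (n : ℕ) (a φ : ℝ) :
    logCosTaylor n a φ =
      2 * (Complex.logTaylor n (a * Complex.exp (φ * Complex.I))).re := by
  rw [logCosTaylor, Complex.logTaylor, Complex.re_sum, Finset.mul_sum]
  refine Finset.sum_congr rfl fun j _ => ?_
  have : (-1 : ℂ) ^ (j + 1) * (a * Complex.exp (φ * Complex.I)) ^ j / j =
      (((-1) ^ (j + 1) * a ^ j / j : ℝ) : ℂ) * Complex.exp ((j * φ : ℝ) * Complex.I) := by
    rw [mul_pow, ← Complex.exp_nat_mul]
    push_cast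
    ring_nf
  rw [this, Complex.re_ofReal_mul, Complex.exp_ofReal_mul_I_re]
  ring

lemma isBigO_log_sub_logCosTaylor (n : ℕ) {m : ℕ} (hm : m ≠ 0) :
    (fun q : ℝ × ℝ => Real.log (1 + 2 * q.1 ^ m * Real.cos q.2 + (q.1 ^ m) ^ 2) -
      logCosTaylor (n + 1) (q.1 ^ m) q.2) =O[nomeFilter] (fun q => (q.1 ^ m) ^ (n + 1)) := by
  let z : ℝ × ℝ → ℂ := fun q => (q.1 ^ m : ℝ) * Complex.exp (q.2 * Complex.I)
  have hz : Tendsto z nomeFilter (𝓝 0) := by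
    rw [tendsto_zero_iff_norm_tendsto_zero]
    simpa [z, Complex.norm_exp_ofReal_mul_I, hm] using (tendsto_fst_nomeFilter.pow m).norm
  have h := (Complex.log_sub_logTaylor_isBigO n).comp_tendsto hz
  have h2 := (((isBigO_of_le nomeFilter
    (fun q => by exact Complex.abs_re_le_norm _)).trans h).const_mul_left (2 : ℝ)).norm_right
  refine h2.congr_left (fun q => ?_) |>.trans (isBigO_of_le _ fun q => ?_)
  · simp only [log_one_add_two_mul_cos_eq, logCosTaylor_eq, Function.comp, Complex.sub_re, z]
    ring
  · simp [z, Complex.norm_exp_ofReal_mul_I]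

/-- The theta series `1 + 2 ∑_{n ≥ 1} r ^ (n ^ 2) cos (n φ)`. -/
noncomputable def cosTheta (r φ : ℝ) : ℝ :=
  1 + ∑' n : ℕ, 2 * Real.cos ((n + 1) * φ) * r ^ ((n + 1) ^ 2)

/-- The partial sum of `cosTheta` with frequencies at most `3`. -/
noncomputable def cosThetaTrunc (r φ : ℝ) : ℝ :=
  1 + 2 * r * Real.cos φ + 2 * r ^ 4 * Real.cos (2 * φ) + 2 * r ^ 9 * Real.cos (3 * φ)

lemma wrapped_normal_eq_cosTheta {γ : ℝ} (hγ : 0 < γ) (φ : ℝ) :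
    (1 / Real.sqrt (2 * π * γ)) * ∑' k : ℤ, Real.exp (-(φ + 2 * π * k) ^ 2 / (2 * γ)) =
      1 / (2 * π) * cosTheta (Real.exp (-γ / 2)) φ := by
  have hπ := Real.pi_pos
  have ht : 0 < 2 * π / γ := by positivity
  have h1 := (HurwitzZeta.hasSum_int_evenKernel (φ / (2 * π)) ht).tsum_eq
  have h2 := (HurwitzZeta.hasSum_nat_cosKernel₀ (φ / (2 * π)) (one_div_pos.2 ht)).tsum_eq
  have e1 : ∀ k : ℤ, Real.exp (-(φ + 2 * π * k) ^ 2 / (2 * γ)) =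
      Real.exp (-π * (k + φ / (2 * π)) ^ 2 * (2 * π / γ)) := fun k => by
    congr 1
    field_simp
    ring
  have e2 : ∀ n : ℕ, 2 * Real.cos ((n + 1) * φ) * Real.exp (-γ / 2) ^ ((n + 1) ^ 2) =
      2 * Real.cos (2 * π * (φ / (2 * π)) * (n + 1)) *
        Real.exp (-π * (n + 1) ^ 2 * (1 / (2 * π / γ))) := fun n => by
    rw [← Real.exp_nat_mul]
    congr 2
    · congr 1
      field_simp
    · push_cast
      field_simp
  rw [cosTheta, tsum_congr e1, tsum_congr e2, h1, h2, HurwitzZeta.evenKernel_functional_equation,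
    ← Real.sqrt_eq_rpow, add_sub_cancel, ← mul_assoc]
  congr 1
  rw [div_mul_div_comm, one_mul, ← Real.sqrt_mul (by positivity)]
  congr 1
  rw [show 2 * π * γ * (2 * π / γ) = (2 * π) ^ 2 by field_simp, Real.sqrt_sq (by positivity)]

lemma abs_cosTheta_term_le {r : ℝ} (hr : 0 ≤ r) (φ : ℝ) (n : ℕ) :
    ‖2 * Real.cos ((n + 1) * φ) * r ^ ((n + 1) ^ 2)‖ ≤ 2 * r ^ ((n + 1) ^ 2) := by
  rw [norm_mul, norm_mul, Real.norm_of_nonneg (pow_nonneg hr _), Real.norm_two]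
  have := Real.abs_cos_le_one ((n + 1) * φ)
  rw [Real.norm_eq_abs]
  nlinarith [pow_nonneg hr ((n + 1) ^ 2)]

lemma summable_pow_succ_sq {r : ℝ} (hr : 0 ≤ r) (hr1 : r < 1) :
    Summable fun n : ℕ => 2 * r ^ ((n + 1) ^ 2) :=
  ((summable_geometric_of_lt_one hr hr1).of_nonneg_of_le (fun n => by positivity)
    fun n => pow_le_pow_of_le_one hr hr1.le (by nlinarith)).mul_left 2

lemma continuous_cosTheta {r : ℝ} (hr : 0 ≤ r) (hr1 : r < 1) : Continuous (cosTheta r) :=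
  continuous_const.add <| continuous_tsum (fun n => by fun_prop) (summable_pow_succ_sq hr hr1)
    fun n φ => abs_cosTheta_term_le hr φ n

lemma abs_cosTheta_sub_cosThetaTrunc_le {r : ℝ} (hr : 0 ≤ r) (hr1 : r ≤ 1 / 2) (φ : ℝ) :
    |cosTheta r φ - cosThetaTrunc r φ| ≤ 4 * r ^ 12 := by
  have hs := Summable.of_norm_bounded (summable_pow_succ_sq hr (by linarith))
    (abs_cosTheta_term_le hr φ)
  have h := hs.sum_add_tsum_nat_add 3
  have e : cosTheta r φ - cosThetaTrunc r φ =
      ∑' n : ℕ, 2 * Real.cos (((n + 3 : ℕ) + 1) * φ) * r ^ ((n + 3 + 1) ^ 2) := by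
    rw [cosTheta, ← h, cosThetaTrunc]
    norm_num [Finset.sum_range_succ]
    ring
  rw [e, ← Real.norm_eq_abs]
  have hg := (hasSum_geometric_two).mul_left (2 * r ^ 12)
  refine (tsum_of_norm_bounded hg fun n => ?_).trans (by linarith)
  refine (abs_cosTheta_term_le hr φ (n + 3)).trans ?_
  rw [mul_assoc]
  gcongr
  calc r ^ ((n + 3 + 1) ^ 2) ≤ r ^ (12 + n) :=
        pow_le_pow_of_le_one hr (by linarith) (by nlinarith)
    _ = r ^ 12 * r ^ n := pow_add ..
    _ ≤ r ^ 12 * (1 / 2) ^ n := by gcongr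

lemma isBigO_cosTheta_sub_cosThetaTrunc :
    (fun q : ℝ × ℝ => cosTheta q.1 q.2 - cosThetaTrunc q.1 q.2) =O[nomeFilter]
      (fun q => q.1 ^ 12) := by
  refine IsBigO.of_bound 4 ?_
  have h1 : ∀ᶠ q in nomeFilter, q.1 ∈ Set.Ioo (0 : ℝ) (1 / 2) :=
    tendsto_fst.eventually (Ioo_mem_nhdsGT (by norm_num))
  filter_upwards [h1] with q hq
  rw [Real.norm_of_nonneg (pow_nonneg hq.1.le 12)]
  exact abs_cosTheta_sub_cosThetaTrunc_le hq.1.le hq.2.le q.2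

/-- Truncation of the Jacobi triple product for `cosTheta`. -/
noncomputable def tripleProductTrunc (r φ : ℝ) : ℝ :=
  (1 + (-r ^ 2 - r ^ 4 + r ^ 10)) * (1 + 2 * r ^ 1 * Real.cos φ + (r ^ 1) ^ 2) *
    (1 + 2 * r ^ 3 * Real.cos φ + (r ^ 3) ^ 2) * (1 + 2 * r ^ 5 * Real.cos φ + (r ^ 5) ^ 2) *
    (1 + 2 * (r ^ 7 + r ^ 9 + r ^ 11) * Real.cos φ)

lemma isBigO_tripleProductTrunc_sub_cosThetaTrunc :
    (fun q : ℝ × ℝ => tripleProductTrunc q.1 q.2 - cosThetaTrunc q.1 q.2) =O[nomeFilter]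
      (fun q => q.1 ^ 12) := by
  refine isBigO_pow_of_eq_mul (h := fun (r, c) =>
    (-2*c)*r + (-2 + -4*c^2)*r^2 + (-6*c)*r^3 + (1 + -24*c^2 + 16*c^4)*r^4 +
    (-16*c^3)*r^5 + (1 + -16*c^2)*r^6 + (-4*c + -16*c^3)*r^7 + (-1 + -4*c^2 + -16*c^4)*r^8 +
    (-2*c + -16*c^3)*r^9 + (8*c^2 + -32*c^4)*r^10 + (2*c + -16*c^3)*r^11 +
    (4*c^2 + -16*c^4)*r^12 + (2*c + -8*c^3)*r^13 + (1 + -12*c^2 + 16*c^4)*r^14 + (4*c)*r^15 +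
    (1 + -4*c^2 + 16*c^4)*r^16 + (16*c^3)*r^17 + (4*c^2 + 16*c^4)*r^18 +
    (-2*c + 24*c^3)*r^19 + (16*c^2)*r^20 + (2*c + 16*c^3)*r^21 + (16*c^2)*r^22 +
    (4*c + 8*c^3)*r^23 + (8*c^2)*r^24 + (4*c)*r^25 + (4*c^2)*r^26 + (2*c)*r^27)
    12 (by fun_prop) fun q => ?_
  simp only [tripleProductTrunc, cosThetaTrunc, Real.cos_two_mul, Real.cos_three_mul]
  ring

/-- Trigonometric polynomial approximating `log (cosTheta r φ)`. -/
noncomputable def logCosThetaTrunc (r φ : ℝ) : ℝ :=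
  Real.log (1 + (-r ^ 2 - r ^ 4 + r ^ 10)) + logCosTaylor 12 (r ^ 1) φ +
    logCosTaylor 4 (r ^ 3) φ + logCosTaylor 4 (r ^ 5) φ +
    2 * (r ^ 7 + r ^ 9 + r ^ 11) * Real.cos φ

lemma tendsto_nhds_one_of_sub_isBigO {F : ℝ × ℝ → ℝ}
    (hF : (fun q => F q - 1) =O[nomeFilter] (fun q => q.1 ^ 1)) :
    Tendsto F nomeFilter (𝓝 1) := by
  simpa using (tendsto_zero_of_isBigO_pow one_ne_zero hF).add_const 1

lemma isBigO_log_tripleProductTrunc_sub :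
    (fun q : ℝ × ℝ => Real.log (tripleProductTrunc q.1 q.2) - logCosThetaTrunc q.1 q.2)
      =O[nomeFilter] (fun q => q.1 ^ 12) := by
  have hA : Tendsto (fun q : ℝ × ℝ => 1 + (-q.1 ^ 2 - q.1 ^ 4 + q.1 ^ 10)) nomeFilter (𝓝 1) :=
    tendsto_nhds_one_of_sub_isBigO
      (isBigO_pow_of_eq_mul (h := fun (r, _) => -r - r ^ 3 + r ^ 9) 1 (by fun_prop)
        fun q => by ring)
  have hP : ∀ m : ℕ, m ≠ 0 → Tendsto
      (fun q : ℝ × ℝ => 1 + 2 * q.1 ^ m * Real.cos q.2 + (q.1 ^ m) ^ 2) nomeFilter (𝓝 1) := by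
    intro m hm
    obtain ⟨k, rfl⟩ := Nat.exists_eq_succ_of_ne_zero hm
    exact tendsto_nhds_one_of_sub_isBigO
      (isBigO_pow_of_eq_mul (h := fun (r, c) => 2 * r ^ k * c + r * (r ^ k) ^ 2) 1
        (by fun_prop) fun q => by simp only [Nat.succ_eq_add_one]; ring)
  have hU : (fun q : ℝ × ℝ => 2 * (q.1 ^ 7 + q.1 ^ 9 + q.1 ^ 11) * Real.cos q.2)
      =O[nomeFilter] (fun q => q.1 ^ 7) :=
    isBigO_pow_of_eq_mul (h := fun (r, c) => 2 * (1 + r ^ 2 + r ^ 4) * c) 7 (by fun_prop)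
      fun q => by ring
  have hU0 := tendsto_zero_of_isBigO_pow (by norm_num) hU
  have hU1 : Tendsto (fun q : ℝ × ℝ => 1 + 2 * (q.1 ^ 7 + q.1 ^ 9 + q.1 ^ 11) * Real.cos q.2)
      nomeFilter (𝓝 1) := by simpa using hU0.const_add 1
  have hlogU := (((isBigO_log_one_add_sub_logTaylorReal 1).comp_tendsto hU0).trans
    (hU.pow 2)).trans (by simpa [← pow_mul] using isBigO_pow_pow_of_le (show 12 ≤ 14 by norm_num))
  have h1 := isBigO_log_sub_logCosTaylor 11 one_ne_zero
  have h3 := isBigO_log_sub_logCosTaylor 3 three_ne_zero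
  have h5 := (isBigO_log_sub_logCosTaylor 3 (show 5 ≠ 0 by norm_num)).trans
    (by simpa [← pow_mul] using isBigO_pow_pow_of_le (show 12 ≤ 20 by norm_num))
  simp only [← pow_mul] at h1 h3
  refine (((h1.add h3).add h5).add hlogU).congr' ?_ .rfl
  filter_upwards [hA.eventually_ne one_ne_zero, (hP 1 one_ne_zero).eventually_ne one_ne_zero,
    (hP 3 three_ne_zero).eventually_ne one_ne_zero, (hP 5 (by norm_num)).eventually_ne one_ne_zero,
    hU1.eventually_ne one_ne_zero] with q q1 q2 q3 q4 q5
  rw [tripleProductTrunc, logCosThetaTrunc, Real.log_mul (by positivity) q5,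
    Real.log_mul (by positivity) q4, Real.log_mul (by positivity) q3, Real.log_mul q1 q2]
  simp only [Function.comp, logTaylorReal, Finset.sum_range_succ]
  simp [← pow_mul]
  ring

lemma isBigO_cosThetaTrunc_sub_one :
    (fun q : ℝ × ℝ => cosThetaTrunc q.1 q.2 - 1) =O[nomeFilter] (fun q => q.1 ^ 1) := by
  refine isBigO_pow_of_eq_mul (h := fun (r, c) =>
    2 * c + 2 * r ^ 3 * (2 * c ^ 2 - 1) + 2 * r ^ 8 * (4 * c ^ 3 - 3 * c)) 1 (by fun_prop)
    fun q => ?_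
  simp only [cosThetaTrunc, Real.cos_two_mul, Real.cos_three_mul]
  ring

lemma tendsto_cosTheta : Tendsto (fun q : ℝ × ℝ => cosTheta q.1 q.2) nomeFilter (𝓝 1) := by
  refine tendsto_nhds_one_of_sub_isBigO ?_
  refine ((isBigO_cosTheta_sub_cosThetaTrunc.trans
    (isBigO_pow_pow_of_le (by norm_num))).add isBigO_cosThetaTrunc_sub_one).congr_left
    fun q => by ring

lemma tendsto_tripleProductTrunc :
    Tendsto (fun q : ℝ × ℝ => tripleProductTrunc q.1 q.2) nomeFilter (𝓝 1) := by
  refine tendsto_nhds_one_of_sub_isBigO ?_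
  refine ((isBigO_tripleProductTrunc_sub_cosThetaTrunc.trans
    (isBigO_pow_pow_of_le (by norm_num))).add isBigO_cosThetaTrunc_sub_one).congr_left
    fun q => by ring

lemma isBigO_log_cosTheta_sub :
    (fun q : ℝ × ℝ => Real.log (cosTheta q.1 q.2) - logCosThetaTrunc q.1 q.2)
      =O[nomeFilter] (fun q => q.1 ^ 12) := by
  have h1 : (fun q : ℝ × ℝ => cosTheta q.1 q.2 - tripleProductTrunc q.1 q.2)
      =O[nomeFilter] (fun q => q.1 ^ 12) :=
    (isBigO_cosTheta_sub_cosThetaTrunc.sub isBigO_tripleProductTrunc_sub_cosThetaTrunc).congr_left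
      fun q => by ring
  exact (((isBigO_log_sub_log tendsto_cosTheta tendsto_tripleProductTrunc).trans h1).add
    isBigO_log_tripleProductTrunc_sub).congr_left fun q => by ring

lemma isBigO_cosTheta_mul_log_sub :
    (fun q : ℝ × ℝ => cosTheta q.1 q.2 * Real.log (cosTheta q.1 q.2) -
      cosThetaTrunc q.1 q.2 * logCosThetaTrunc q.1 q.2) =O[nomeFilter] (fun q => q.1 ^ 12) := by
  have hlog : (fun q : ℝ × ℝ => Real.log (cosTheta q.1 q.2)) =O[nomeFilter]
      (fun _ => (1 : ℝ)) :=
    (tendsto_cosTheta.log one_ne_zero).isBigO_one ℝ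
  have htr : (fun q : ℝ × ℝ => cosThetaTrunc q.1 q.2) =O[nomeFilter] (fun _ => (1 : ℝ)) :=
    (tendsto_nhds_one_of_sub_isBigO isBigO_cosThetaTrunc_sub_one).isBigO_one ℝ
  have h := (isBigO_cosTheta_sub_cosThetaTrunc.mul hlog).add
    ((htr.mul isBigO_log_cosTheta_sub).congr_right fun q => by ring)
  simp only [mul_one] at h
  exact h.congr_left fun q => by ring

lemma integral_cos_int_mul (m : ℤ) :
    ∫ φ in (-π)..π, Real.cos (m * φ) = if m = 0 then 2 * π else 0 := by
  split_ifs with hm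
  · simp [hm]
    ring
  · have : (m : ℝ) ≠ 0 := by exact_mod_cast hm
    rw [intervalIntegral.integral_comp_mul_left Real.cos this, integral_cos, mul_neg, Real.sin_neg,
      Real.sin_int_mul_pi]
    simp

@[fun_prop]
lemma continuous_logCosTaylor (n : ℕ) (a : ℝ) : Continuous (logCosTaylor n a) := by
  unfold logCosTaylor
  fun_prop

lemma integral_cos_mul_cos (k j : ℕ) :
    ∫ φ in (-π)..π, Real.cos (k * φ) * Real.cos (j * φ) =
      if k = j then (if k = 0 then 2 * π else π) else 0 := by
  have e : ∀ φ : ℝ, Real.cos (k * φ) * Real.cos (j * φ) =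
      (1 / 2) * Real.cos (((k - j : ℤ) : ℝ) * φ) + (1 / 2) * Real.cos (((k + j : ℤ) : ℝ) * φ) := by
    intro φ
    push_cast
    rw [sub_mul, add_mul, Real.cos_sub, Real.cos_add]
    ring
  simp_rw [e]
  rw [intervalIntegral.integral_add (Continuous.intervalIntegrable (by fun_prop) _ _)
    (Continuous.intervalIntegrable (by fun_prop) _ _), intervalIntegral.integral_const_mul,
    intervalIntegral.integral_const_mul, integral_cos_int_mul, integral_cos_int_mul]
  by_cases h : k = j
  · subst h
    by_cases hk : k = 0
    · simp [hk]
      ring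
    · have : (k : ℤ) + k ≠ 0 := by omega
      simp [hk, this]
  · have h1 : (k : ℤ) - j ≠ 0 := by omega
    have h2 : (k : ℤ) + j ≠ 0 := by omega
    simp [h, h1, h2]

lemma integral_cos_mul_logCosTaylor {k n : ℕ} (hk : k < n) (a : ℝ) :
    ∫ φ in (-π)..π, Real.cos (k * φ) * logCosTaylor n a φ =
      2 * π * ((-1) ^ (k + 1) * a ^ k / k) := by
  simp only [logCosTaylor, Finset.mul_sum]
  rw [intervalIntegral.integral_finsetSum
    fun j _ => Continuous.intervalIntegrable (by fun_prop) _ _]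
  simp_rw [mul_left_comm (Real.cos (k * _)), intervalIntegral.integral_const_mul,
    integral_cos_mul_cos]
  rw [Finset.sum_eq_single_of_mem k (Finset.mem_range.2 hk) fun j _ hj => by simp [hj.symm]]
  by_cases h : k = 0
  · simp [h]
  · simp [h]
    ring

lemma integral_cos_mul_logCosThetaTrunc {k : ℕ} (hk : k < 4) (r : ℝ) :
    ∫ φ in (-π)..π, Real.cos (k * φ) * logCosThetaTrunc r φ =
      2 * π * ((if k = 0 then Real.log (1 + (-r ^ 2 - r ^ 4 + r ^ 10)) else 0) +
        (-1) ^ (k + 1) * ((r ^ 1) ^ k + (r ^ 3) ^ k + (r ^ 5) ^ k) / k +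
        if k = 1 then r ^ 7 + r ^ 9 + r ^ 11 else 0) := by
  set L := Real.log (1 + (-r ^ 2 - r ^ 4 + r ^ 10))
  have e : ∀ φ : ℝ, Real.cos (k * φ) * logCosThetaTrunc r φ =
      L * Real.cos (((k : ℤ) : ℝ) * φ) + Real.cos (k * φ) * logCosTaylor 12 (r ^ 1) φ +
        Real.cos (k * φ) * logCosTaylor 4 (r ^ 3) φ +
        Real.cos (k * φ) * logCosTaylor 4 (r ^ 5) φ +
        2 * (r ^ 7 + r ^ 9 + r ^ 11) * (Real.cos (k * φ) * Real.cos ((1 : ℕ) * φ)) := by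
    intro φ
    rw [logCosThetaTrunc, Nat.cast_one, one_mul, Int.cast_natCast]
    ring
  simp_rw [e]
  iterate 4 rw [intervalIntegral.integral_add (Continuous.intervalIntegrable (by fun_prop) _ _)
    (Continuous.intervalIntegrable (by fun_prop) _ _)]
  rw [intervalIntegral.integral_const_mul, intervalIntegral.integral_const_mul,
    integral_cos_int_mul, integral_cos_mul_cos, integral_cos_mul_logCosTaylor (by omega),
    integral_cos_mul_logCosTaylor hk, integral_cos_mul_logCosTaylor hk]
  by_cases h0 : k = 0
  · simp [h0]
    ring
  · by_cases h1 : k = 1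
    · simp [h1]
      ring
    · simp [h0, h1]
      ring

@[fun_prop]
lemma continuous_logCosThetaTrunc (r : ℝ) : Continuous (logCosThetaTrunc r) := by
  unfold logCosThetaTrunc
  fun_prop

@[fun_prop]
lemma continuous_cosThetaTrunc (r : ℝ) : Continuous (cosThetaTrunc r) := by
  unfold cosThetaTrunc
  fun_prop

lemma integral_cosThetaTrunc_mul_logCosThetaTrunc (r : ℝ) :
    ∫ φ in (-π)..π, cosThetaTrunc r φ * logCosThetaTrunc r φ =
      2 * π * (Real.log (1 + (-r ^ 2 - r ^ 4 + r ^ 10)) +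
        2 * r * (r + r ^ 3 + r ^ 5 + r ^ 7 + r ^ 9 + r ^ 11) -
        r ^ 4 * (r ^ 2 + r ^ 6 + r ^ 10) + 2 / 3 * r ^ 9 * (r ^ 3 + r ^ 9 + r ^ 15)) := by
  have e : ∀ φ : ℝ, cosThetaTrunc r φ * logCosThetaTrunc r φ =
      Real.cos ((0 : ℕ) * φ) * logCosThetaTrunc r φ +
        2 * r * (Real.cos ((1 : ℕ) * φ) * logCosThetaTrunc r φ) +
        2 * r ^ 4 * (Real.cos ((2 : ℕ) * φ) * logCosThetaTrunc r φ) +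
        2 * r ^ 9 * (Real.cos ((3 : ℕ) * φ) * logCosThetaTrunc r φ) := by
    intro φ
    rw [cosThetaTrunc]
    push_cast
    rw [zero_mul, Real.cos_zero, one_mul, one_mul]
    ring
  simp_rw [e]
  iterate 3 rw [intervalIntegral.integral_add (Continuous.intervalIntegrable (by fun_prop) _ _)
    (Continuous.intervalIntegrable (by fun_prop) _ _)]
  simp only [intervalIntegral.integral_const_mul]
  rw [integral_cos_mul_logCosThetaTrunc (by norm_num),
    integral_cos_mul_logCosThetaTrunc (by norm_num),
    integral_cos_mul_logCosThetaTrunc (by norm_num),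
    integral_cos_mul_logCosThetaTrunc (by norm_num)]
  norm_num
  ring

lemma isBigO_mean_trunc_sub :
    (fun q : ℝ × ℝ => (Real.log (1 + (-q.1 ^ 2 - q.1 ^ 4 + q.1 ^ 10)) +
        2 * q.1 * (q.1 + q.1 ^ 3 + q.1 ^ 5 + q.1 ^ 7 + q.1 ^ 9 + q.1 ^ 11) -
        q.1 ^ 4 * (q.1 ^ 2 + q.1 ^ 6 + q.1 ^ 10) +
        2 / 3 * q.1 ^ 9 * (q.1 ^ 3 + q.1 ^ 9 + q.1 ^ 15)) -
        (2 * q.1 ^ 2 - Real.log (1 + q.1 ^ 2))) =O[nomeFilter] (fun q => q.1 ^ 12) := by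
  have hA : Tendsto (fun q : ℝ × ℝ => 1 + (-q.1 ^ 2 - q.1 ^ 4 + q.1 ^ 10)) nomeFilter (𝓝 1) :=
    tendsto_nhds_one_of_sub_isBigO
      (isBigO_pow_of_eq_mul (h := fun (r, _) => -r - r ^ 3 + r ^ 9) 1 (by fun_prop)
        fun q => by ring)
  have hY : (fun q : ℝ × ℝ => -2 * q.1 ^ 4 - q.1 ^ 6 + q.1 ^ 10 + q.1 ^ 12)
      =O[nomeFilter] (fun q => q.1 ^ 4) :=
    isBigO_pow_of_eq_mul (h := fun (r, _) => -2 - r ^ 2 + r ^ 6 + r ^ 8) 4 (by fun_prop)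
      fun q => by ring
  have hlog := ((isBigO_log_one_add_sub_logTaylorReal 2).comp_tendsto
    (tendsto_zero_of_isBigO_pow (by norm_num) hY)).trans (hY.pow 3)
  simp only [← pow_mul] at hlog
  have hR := isBigO_pow_of_eq_mul (F := fun q : ℝ × ℝ =>
      logTaylorReal 3 (-2 * q.1 ^ 4 - q.1 ^ 6 + q.1 ^ 10 + q.1 ^ 12) +
        2 * q.1 * (q.1 + q.1 ^ 3 + q.1 ^ 5 + q.1 ^ 7 + q.1 ^ 9 + q.1 ^ 11) -
        q.1 ^ 4 * (q.1 ^ 2 + q.1 ^ 6 + q.1 ^ 10) +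
        2 / 3 * q.1 ^ 9 * (q.1 ^ 3 + q.1 ^ 9 + q.1 ^ 15) - 2 * q.1 ^ 2)
    (h := fun (r, _) => 3 - r ^ 2 + 2 / 3 * (1 + r ^ 6 + r ^ 12) - 1 / 2 * (1 - 4 * r ^ 2 -
      6 * r ^ 4 - 2 * r ^ 6 + r ^ 8 + 2 * r ^ 10 + r ^ 12)) 12 (by fun_prop) fun q => by
      simp only [logTaylorReal, Finset.sum_range_succ]
      norm_num
      ring
  refine (hlog.add hR).congr' ?_ .rfl
  filter_upwards [hA.eventually_ne one_ne_zero] with q hq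
  have : Real.log (1 + (-2 * q.1 ^ 4 - q.1 ^ 6 + q.1 ^ 10 + q.1 ^ 12)) =
      Real.log (1 + (-q.1 ^ 2 - q.1 ^ 4 + q.1 ^ 10)) + Real.log (1 + q.1 ^ 2) := by
    rw [← Real.log_mul hq (by positivity)]
    ring_nf
  simp only [Function.comp, this]
  ring

lemma isBigO_mean_cosTheta_mul_log_sub :
    (fun r : ℝ => (2 * π)⁻¹ * (∫ φ in (-π)..π, cosTheta r φ * Real.log (cosTheta r φ)) -
      (2 * r ^ 2 - Real.log (1 + r ^ 2))) =O[𝓝[>] 0] (fun r => r ^ 12) := by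
  obtain ⟨C₁, h₁⟩ := isBigO_cosTheta_mul_log_sub.bound
  obtain ⟨C₂, h₂⟩ := isBigO_mean_trunc_sub.bound
  refine IsBigO.of_bound (C₁ + C₂) ?_
  filter_upwards [mem_prod_top.1 h₁, mem_prod_top.1 h₂, Ioo_mem_nhdsGT (one_pos (α := ℝ))]
    with r hr₁ hr₂ hr
  have hcont : Continuous fun φ => cosTheta r φ * Real.log (cosTheta r φ) :=
    Real.continuous_mul_log.comp (continuous_cosTheta hr.1.le hr.2)
  have hsub := intervalIntegral.integral_sub (hcont.intervalIntegrable (-π) π)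
    (Continuous.intervalIntegrable (μ := volume)
      (u := fun φ => cosThetaTrunc r φ * logCosThetaTrunc r φ) (by fun_prop) (-π) π)
  have hle := intervalIntegral.norm_integral_le_of_norm_le_const (a := -π) (b := π)
    fun φ _ => hr₁ φ
  rw [hsub, integral_cosThetaTrunc_mul_logCosThetaTrunc,
    show |π - -π| = 2 * π by rw [abs_of_pos] <;> linarith [Real.pi_pos]] at hle
  set J := ∫ φ in (-π)..π, cosTheta r φ * Real.log (cosTheta r φ)
  have hm := hr₂ 0
  set M := Real.log (1 + (-r ^ 2 - r ^ 4 + r ^ 10)) +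
        2 * r * (r + r ^ 3 + r ^ 5 + r ^ 7 + r ^ 9 + r ^ 11) -
        r ^ 4 * (r ^ 2 + r ^ 6 + r ^ 10) + 2 / 3 * r ^ 9 * (r ^ 3 + r ^ 9 + r ^ 15)
  have hπ : 0 < 2 * π := by positivity
  have h : ‖(2 * π)⁻¹ * J - M‖ ≤ C₁ * ‖r ^ 12‖ := by
    rw [show (2 * π)⁻¹ * J - M = (2 * π)⁻¹ * (J - 2 * π * M) by field_simp, norm_mul, norm_inv,
      Real.norm_of_nonneg hπ.le, inv_mul_le_iff₀ hπ]
    linarith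
  rw [add_mul]
  exact (norm_sub_le_norm_sub_add_norm_sub _ M _).trans (add_le_add h hm)

lemma isBigO_wrapped_normal_entropy (p : ℝ → ℝ → ℝ)
    (hp : ∀ γ : ℝ, 0 < γ → ∀ φ : ℝ, p γ φ =
      (1 / Real.sqrt (2 * π * γ)) * ∑' k : ℤ, Real.exp (-(φ + 2 * π * k) ^ 2 / (2 * γ))) :
    (fun γ : ℝ => (∫ φ in (-π)..π, p γ φ * Real.logb 2 (2 * π * p γ φ)) -
      ((2 / Real.log 2) * Real.exp (-γ) - Real.logb 2 (1 + Real.exp (-γ))))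
      =O[atTop] (fun γ => Real.exp (-6 * γ)) := by
  have hexp : Tendsto (fun γ : ℝ => Real.exp (-γ / 2)) atTop (𝓝[>] 0) := by
    refine tendsto_nhdsWithin_iff.2 ⟨?_, .of_forall fun γ => Real.exp_pos _⟩
    refine Real.tendsto_exp_neg_atTop_nhds_zero.comp
      (tendsto_id.atTop_div_const two_pos) |>.congr fun γ => ?_
    simp [neg_div]
  have h := (isBigO_mean_cosTheta_mul_log_sub.comp_tendsto hexp).const_mul_left (Real.log 2)⁻¹
  refine h.congr' ?_ (.of_forall fun γ => ?_)
  · filter_upwards [eventually_gt_atTop 0] with γ hγ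
    have e : ∀ φ, p γ φ * Real.logb 2 (2 * π * p γ φ) = (Real.log 2)⁻¹ * ((2 * π)⁻¹ *
        (cosTheta (Real.exp (-γ / 2)) φ * Real.log (cosTheta (Real.exp (-γ / 2)) φ))) := by
      intro φ
      rw [hp γ hγ, wrapped_normal_eq_cosTheta hγ, ← mul_assoc,
        mul_one_div_cancel (by positivity), one_mul, Real.logb]
      ring
    have e2 : Real.exp (-γ / 2) ^ 2 = Real.exp (-γ) := by
      rw [← Real.exp_nat_mul]
      congr 1
      push_cast
      ring
    simp_rw [e, intervalIntegral.integral_const_mul]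
    simp only [Function.comp, e2, Real.logb]
    ring
  · simp only [Function.comp]
    rw [← Real.exp_nat_mul]
    congr 1
    push_cast
    ring

lemma exists_pos_bound_of_isBigO_atTop {F G : ℝ → ℝ} (h : F =O[atTop] G)
    (hG : ∀ γ, 0 ≤ G γ) :
    ∃ C Γ : ℝ, 0 < C ∧ 0 < Γ ∧ ∀ γ : ℝ, Γ ≤ γ → |F γ| ≤ C * G γ := by
  obtain ⟨C, hC, hb⟩ := h.exists_pos
  obtain ⟨Γ, hΓ⟩ := eventually_atTop.1 hb.bound
  refine ⟨C, max Γ 1, hC, by positivity, fun γ hγ => ?_⟩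
  simpa [abs_of_nonneg (hG γ)] using hΓ γ (le_of_max_le_left hγ)

/-- large-dephasing limit. For the wrapped normal density `p_γ` on
`[-π, π]`, the Kullback–Leibler divergence from the uniform density
`D(p_γ‖u) = ∫ p_γ log₂(2π p_γ) dφ` satisfies, as `γ → ∞`,
`D(p_γ‖u) = (2/ln 2)e^{-γ} − log₂(1 + e^{-γ}) + O(e^{-6γ}) = e^{-γ}/ln 2 + O(e^{-2γ})`. -/
theorem wrapped_normal_relative_entropy_large_dephasing
    (p : ℝ → ℝ → ℝ)
    (hp : ∀ γ : ℝ, 0 < γ → ∀ φ : ℝ, p γ φ =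
      (1 / Real.sqrt (2 * π * γ)) * ∑' k : ℤ, Real.exp (-(φ + 2 * π * k) ^ 2 / (2 * γ))) :
    (∃ C Γ : ℝ, 0 < C ∧ 0 < Γ ∧ ∀ γ : ℝ, Γ ≤ γ →
      |(∫ φ in (-π)..π, p γ φ * Real.logb 2 (2 * π * p γ φ)) -
          ((2 / Real.log 2) * Real.exp (-γ) - Real.logb 2 (1 + Real.exp (-γ)))| ≤
        C * Real.exp (-6 * γ)) ∧
    (∃ C Γ : ℝ, 0 < C ∧ 0 < Γ ∧ ∀ γ : ℝ, Γ ≤ γ →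
      |(∫ φ in (-π)..π, p γ φ * Real.logb 2 (2 * π * p γ φ)) -
          Real.exp (-γ) / Real.log 2| ≤ C * Real.exp (-2 * γ)) := by
  have h := isBigO_wrapped_normal_entropy p hp
  refine ⟨exists_pos_bound_of_isBigO_atTop h fun γ => (Real.exp_pos _).le,
    exists_pos_bound_of_isBigO_atTop ?_ fun γ => (Real.exp_pos _).le⟩
  have h6 : (fun γ : ℝ => Real.exp (-6 * γ)) =O[atTop] (fun γ => Real.exp (-2 * γ)) := by
    refine IsBigO.of_bound 1 ?_
    filter_upwards [eventually_ge_atTop 0] with γ hγ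
    simpa using by linarith
  have h2 := ((isBigO_log_one_add_sub_logTaylorReal 1).comp_tendsto
    Real.tendsto_exp_neg_atTop_nhds_zero).const_mul_left (-(Real.log 2)⁻¹)
  have h3 : (fun γ : ℝ => -(Real.log 2)⁻¹ * (Real.log (1 + Real.exp (-γ)) - Real.exp (-γ)))
      =O[atTop] (fun γ => Real.exp (-2 * γ)) := by
    refine h2.congr (fun γ => ?_) fun γ => ?_
    · simp [logTaylorReal, Finset.sum_range_succ]
    · simp only [Function.comp]
      rw [← Real.exp_nat_mul]
      congr 1
      push_cast
      ring
  refine ((h.trans h6).add h3).congr_left fun γ => ?_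
  rw [Real.logb]
  ring
end

section
/- (Multi-index Szegő-type theorem, nonnegative symbols.) Let m ∈ ℕ₊, let a : [-π, π]ᵐ → ℝ≥0 be measurable with ∫_{[-π,π]ᵐ} a(𝛗)^α d^m𝛗/(2π)^m < ∞ for some α ≥ 1, and let F : ℝ≥0 → ℝ be continuous with F(x) = O(x^α) as x → ∞. For 𝐝 = (d₁, …, d_m) ∈ ℕ₊ᵐ let T⁽𝐝⁾ be the D(𝐝) × D(𝐝) matrix, D(𝐝) = ∏_j d_j, indexed by multi-indices 𝐡, 𝐤 with 0 ≤ h_j, k_j ≤ d_j − 1, with entries T⁽𝐝⁾_{𝐡,𝐤} = ∫_{[-π,π]ᵐ} a(𝛗) e^{-i(𝐡−𝐤)·𝛗} d^m𝛗/(2π)^m; it is Hermitian positive semidefinite with eigenvalues λ₁, …, λ_{D(𝐝)}. Then as min_j d_j → ∞, (1/D(𝐝)) Σ_{j=1}^{D(𝐝)} F(λ_j(T⁽𝐝⁾)) → ∫_{[-π,π]ᵐ} F(a(𝛗)) d^m𝛗/(2π)^m. -/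
open scoped Real ComplexOrder
open MeasureTheory Filter

/-! ### Convergence of averages against continuous functions of controlled growth -/

/-- A function into `ℝ` that is eventually uniformly close to convergent functions converges. -/
lemma tendsto_of_forall_approx {D : Type*} {l : Filter D} {u : D → ℝ} {x : ℝ}
    (H : ∀ ε > 0, ∃ (v : D → ℝ) (y : ℝ), Tendsto v l (nhds y) ∧ (∀ᶠ d in l, |u d - v d| ≤ ε) ∧
      |x - y| ≤ ε) : Tendsto u l (nhds x) := by
  rw [Metric.tendsto_nhds]
  intro ε hε
  obtain ⟨v, y, hv, huv, hxy⟩ := H (ε / 4) (by positivity)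
  filter_upwards [huv, Metric.tendsto_nhds.1 hv (ε / 4) (by positivity)] with d h1 h2
  rw [Real.dist_eq] at h2 ⊢
  rw [abs_le] at h1 hxy
  rw [abs_lt] at h2 ⊢
  constructor <;> linarith [h1.1, h1.2, h2.1, h2.2, hxy.1, hxy.2]

/-- The average of `G` over a finite family of reals. -/
noncomputable def familyAverage {ι : Type*} [Fintype ι] (ev : ι → ℝ) (G : ℝ → ℝ) : ℝ :=
  (1 / (Fintype.card ι : ℝ)) * ∑ i, G (ev i)

section familyAverage

variable {ι : Type*} [Fintype ι] {ev : ι → ℝ}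

lemma familyAverage_add (G H : ℝ → ℝ) :
    familyAverage ev (fun x => G x + H x) = familyAverage ev G + familyAverage ev H := by
  simp only [familyAverage, Finset.sum_add_distrib, mul_add]

lemma familyAverage_sub (G H : ℝ → ℝ) :
    familyAverage ev (fun x => G x - H x) = familyAverage ev G - familyAverage ev H := by
  simp only [familyAverage, Finset.sum_sub_distrib, mul_sub]

lemma familyAverage_const_mul (c : ℝ) (G : ℝ → ℝ) :
    familyAverage ev (fun x => c * G x) = c * familyAverage ev G := by
  simp only [familyAverage, ← Finset.mul_sum]
  ring

lemma familyAverage_mono (hev : ∀ i, 0 ≤ ev i) {G H : ℝ → ℝ} (h : ∀ x, 0 ≤ x → G x ≤ H x) :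
    familyAverage ev G ≤ familyAverage ev H := by
  unfold familyAverage
  gcongr with i
  exact h _ (hev i)

lemma familyAverage_const_le {c : ℝ} (hc : 0 ≤ c) : familyAverage ev (fun _ => c) ≤ c := by
  simp only [familyAverage, Finset.sum_const, Finset.card_univ, nsmul_eq_mul]
  rcases eq_or_ne (Fintype.card ι : ℝ) 0 with h | h
  · simpa [h] using hc
  · rw [← mul_assoc, one_div_mul_cancel h, one_mul]

lemma abs_familyAverage_sub_le (hev : ∀ i, 0 ≤ ev i) {G H K : ℝ → ℝ}
    (h : ∀ x, 0 ≤ x → |G x - H x| ≤ K x) :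
    |familyAverage ev G - familyAverage ev H| ≤ familyAverage ev K := by
  have h1 := familyAverage_mono hev (G := fun x => G x - H x) (H := K)
    fun x hx => (abs_le.1 (h x hx)).2
  have h2 := familyAverage_mono hev (G := fun x => H x - G x) (H := K)
    fun x hx => by linarith [(abs_le.1 (h x hx)).1]
  rw [familyAverage_sub] at h1 h2
  exact abs_le.2 ⟨by linarith, h1⟩

end familyAverage

section Moments

variable {X : Type*} [MeasurableSpace X] {P : Measure X} [IsProbabilityMeasure P]
  {D : Type*} {l : Filter D} {ι : D → Type*} [∀ d, Fintype (ι d)] {ev : (d : D) → ι d → ℝ}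
  {f : X → ℝ}

lemma integrable_comp_of_bounded (hf : Measurable f) {G : ℝ → ℝ} (hG : Continuous G) {B : ℝ}
    (hB : ∀ x, |G (f x)| ≤ B) : Integrable (fun x => G (f x)) P :=
  Integrable.of_bound (hG.measurable.comp hf).aestronglyMeasurable B (ae_of_all _ hB)

lemma tendsto_familyAverage_polynomial_exp (hf : Measurable f) (hf0 : ∀ x, 0 ≤ f x)
    (hexp : ∀ n : ℕ, Tendsto (fun d => familyAverage (ev d) fun x => Real.exp (-(n * x))) l
      (nhds (∫ x, Real.exp (-(n * f x)) ∂P))) (p : Polynomial ℝ) :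
    Integrable (fun x => p.eval (Real.exp (-f x))) P ∧
    Tendsto (fun d => familyAverage (ev d) fun x => p.eval (Real.exp (-x))) l
      (nhds (∫ x, p.eval (Real.exp (-f x)) ∂P)) := by
  induction p using Polynomial.induction_on' with
  | add p q hp hq =>
    simp only [Polynomial.eval_add, familyAverage_add]
    refine ⟨hp.1.add hq.1, ?_⟩
    rw [integral_add hp.1 hq.1]
    exact hp.2.add hq.2
  | monomial n c =>
    simp only [Polynomial.eval_monomial, familyAverage_const_mul, ← Real.exp_nat_mul, mul_neg]
    refine ⟨Integrable.const_mul ?_ _, ?_⟩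
    · refine integrable_comp_of_bounded hf (G := fun x => Real.exp (-(n * x))) (by fun_prop)
        (B := 1) fun x => ?_
      rw [abs_of_pos (Real.exp_pos _)]
      exact Real.exp_le_one_iff.2 (by have := hf0 x; simp; positivity)
    · rw [integral_const_mul]
      exact (hexp n).const_mul c

lemma tendsto_familyAverage_comp_exp (hf : Measurable f) (hf0 : ∀ x, 0 ≤ f x)
    (hev : ∀ d i, 0 ≤ ev d i)
    (hexp : ∀ n : ℕ, Tendsto (fun d => familyAverage (ev d) fun x => Real.exp (-(n * x))) l
      (nhds (∫ x, Real.exp (-(n * f x)) ∂P))) {g : ℝ → ℝ} (hg : Continuous g) :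
    Tendsto (fun d => familyAverage (ev d) fun x => g (Real.exp (-x))) l
      (nhds (∫ x, g (Real.exp (-f x)) ∂P)) := by
  refine tendsto_of_forall_approx fun ε hε => ?_
  obtain ⟨p, hp⟩ := exists_polynomial_near_of_continuousOn 0 1 g hg.continuousOn ε hε
  obtain ⟨hpi, hpt⟩ := tendsto_familyAverage_polynomial_exp hf hf0 hexp p
  have key : ∀ x : ℝ, 0 ≤ x → |g (Real.exp (-x)) - p.eval (Real.exp (-x))| ≤ ε := fun x hx => by
    rw [abs_sub_comm]
    exact (hp _ ⟨(Real.exp_pos _).le, Real.exp_le_one_iff.2 (by linarith)⟩).le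
  refine ⟨_, _, hpt, Eventually.of_forall fun d => ?_, ?_⟩
  · exact (abs_familyAverage_sub_le (hev d) key).trans (familyAverage_const_le hε.le)
  · obtain ⟨B, hB⟩ := (isCompact_Icc (a := (0 : ℝ)) (b := 1)).exists_bound_of_continuousOn
      hg.continuousOn
    have hgi : Integrable (fun x => g (Real.exp (-f x))) P :=
      integrable_comp_of_bounded hf (G := fun x => g (Real.exp (-x))) (by fun_prop) (B := B)
        fun x => hB _ ⟨(Real.exp_pos _).le, Real.exp_le_one_iff.2 (by linarith [hf0 x])⟩
    rw [← integral_sub hgi hpi, ← Real.norm_eq_abs]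
    calc ‖∫ x, (g (Real.exp (-f x)) - p.eval (Real.exp (-f x))) ∂P‖
        ≤ ε * P.real Set.univ :=
          norm_integral_le_of_norm_le_const (ae_of_all _ fun x => key _ (hf0 x))
      _ = ε := by simp

lemma tendsto_familyAverage_comp_min (hf : Measurable f) (hf0 : ∀ x, 0 ≤ f x)
    (hev : ∀ d i, 0 ≤ ev d i)
    (hexp : ∀ n : ℕ, Tendsto (fun d => familyAverage (ev d) fun x => Real.exp (-(n * x))) l
      (nhds (∫ x, Real.exp (-(n * f x)) ∂P))) {F : ℝ → ℝ} (hF : Continuous F) (R : ℝ) :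
    Tendsto (fun d => familyAverage (ev d) fun x => F (min x R)) l
      (nhds (∫ x, F (min (f x) R) ∂P)) := by
  have hg : Continuous fun y : ℝ => F (-Real.log (max y (Real.exp (-R)))) :=
    hF.comp (Continuous.neg (Continuous.log (by fun_prop)
      fun y => (lt_max_of_lt_right (Real.exp_pos _)).ne'))
  have h := tendsto_familyAverage_comp_exp hf hf0 hev hexp hg
  have key : ∀ x : ℝ, -Real.log (max (Real.exp (-x)) (Real.exp (-R))) = min x R := fun x => by
    rw [← Real.exp_monotone.map_max, Real.log_exp, max_neg_neg, neg_neg]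
  simpa only [key] using h

lemma integrable_comp_of_growth {α : ℝ} (hf : Measurable f) (hf0 : ∀ x, 0 ≤ f x)
    (hfα : Integrable (fun x => f x ^ α) P) {F : ℝ → ℝ} (hF : Continuous F) {C M : ℝ}
    (hC : ∀ x, M ≤ x → |F x| ≤ C * x ^ α) : Integrable (fun x => F (f x)) P := by
  obtain ⟨B, hB⟩ := (isCompact_Icc (a := (0 : ℝ)) (b := M)).exists_bound_of_continuousOn
    hF.continuousOn
  refine Integrable.mono' ((integrable_const |B|).add (hfα.const_mul |C|))
    (hF.measurable.comp hf).aestronglyMeasurable (ae_of_all _ fun x => ?_)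
  have h0 : 0 ≤ f x ^ α := Real.rpow_nonneg (hf0 x) _
  simp only [Pi.add_apply]
  rcases le_total (f x) M with h | h
  · have := hB (f x) ⟨hf0 x, h⟩
    have h2 : 0 ≤ |C| * f x ^ α := by positivity
    linarith [le_abs_self B]
  · have := hC (f x) h
    have h2 : C * f x ^ α ≤ |C| * f x ^ α := by gcongr; exact le_abs_self C
    rw [Real.norm_eq_abs]
    linarith [abs_nonneg B]

/-- If averages of `exp (-n x)` converge and averages of `x ^ α` are asymptotically dominated, then
averages of every continuous function with growth `O(x ^ α)` converge. -/
theorem tendsto_familyAverage_of_growth {α : ℝ} (hα : 1 ≤ α)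
    (hf : Measurable f) (hf0 : ∀ x, 0 ≤ f x) (hfα : Integrable (fun x => f x ^ α) P)
    (hev : ∀ d i, 0 ≤ ev d i)
    (hexp : ∀ n : ℕ, Tendsto (fun d => familyAverage (ev d) fun x => Real.exp (-(n * x))) l
      (nhds (∫ x, Real.exp (-(n * f x)) ∂P)))
    (hpow : ∀ᶠ d in l, familyAverage (ev d) (fun x => x ^ α) ≤ ∫ x, f x ^ α ∂P)
    {F : ℝ → ℝ} (hF : Continuous F) {C M : ℝ} (hC : ∀ x, M ≤ x → |F x| ≤ C * x ^ α) :
    Tendsto (fun d => familyAverage (ev d) F) l (nhds (∫ x, F (f x) ∂P)) := by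
  have hα0 : 0 < α := by linarith
  have hpc : Continuous fun x : ℝ => x ^ α := Real.continuous_rpow_const hα0.le
  have hmin_int : ∀ S : ℝ, 0 ≤ S → Integrable (fun x => min (f x) S ^ α) P := fun S hS =>
    Integrable.of_bound (hpc.measurable.comp (hf.min measurable_const)).aestronglyMeasurable
      (S ^ α) (ae_of_all _ fun x => by
        rw [Real.norm_of_nonneg (Real.rpow_nonneg (le_min (hf0 x) hS) _)]
        exact Real.rpow_le_rpow (le_min (hf0 x) hS) (min_le_right _ _) hα0.le)
  have htail : Tendsto (fun S : ℕ => ∫ x, min (f x) S ^ α ∂P) atTop (nhds (∫ x, f x ^ α ∂P)) := by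
    refine tendsto_integral_of_dominated_convergence (fun x => f x ^ α)
      (fun S => (hmin_int S (Nat.cast_nonneg S)).aestronglyMeasurable) hfα
      (fun S => ae_of_all _ fun x => ?_) (ae_of_all _ fun x => ?_)
    · have h0 : 0 ≤ min (f x) S := le_min (hf0 x) (Nat.cast_nonneg S)
      rw [Real.norm_of_nonneg (Real.rpow_nonneg h0 _)]
      exact Real.rpow_le_rpow h0 (min_le_left _ _) hα0.le
    · refine tendsto_const_nhds.congr' ?_
      filter_upwards [eventually_ge_atTop ⌈f x⌉₊] with S hS
      rw [min_eq_left (Nat.ceil_le.1 hS)]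
  refine tendsto_of_forall_approx fun ε hε => ?_
  set C' := max C 1 with hC'
  have hC'1 : 1 ≤ C' := le_max_right _ _
  have hev1 := (htail.const_mul (4 * C')).eventually
    (lt_mem_nhds (show 4 * C' * (∫ x, f x ^ α ∂P) - ε < 4 * C' * ∫ x, f x ^ α ∂P by linarith))
  obtain ⟨S, hS1, hSM⟩ := (hev1.and (eventually_ge_atTop (max ⌈M⌉₊ 1))).exists
  have hMS : M ≤ S := Nat.ceil_le.1 ((le_max_left _ _).trans hSM)
  have hS0 : (1 : ℝ) ≤ S := by exact_mod_cast (le_max_right _ _).trans hSM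
  have key : ∀ x : ℝ, 0 ≤ x →
      |F x - F (min x (2 * S))| ≤ 4 * C' * (x ^ α - min x S ^ α) := fun x hx => by
    have hmono : min x (S : ℝ) ^ α ≤ x ^ α :=
      Real.rpow_le_rpow (le_min hx (by linarith)) (min_le_left _ _) hα0.le
    rcases le_total x (2 * S) with h | h
    · rw [min_eq_left h, sub_self, abs_zero]
      have : 0 ≤ x ^ α - min x (S : ℝ) ^ α := by linarith
      positivity
    · rw [min_eq_right h]
      have h1 := hC x (by linarith)
      have h2 := hC (2 * S) (by linarith)
      have h3 : (2 * (S : ℝ)) ^ α ≤ x ^ α := Real.rpow_le_rpow (by linarith) h hα0.le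
      have h4 : C * x ^ α ≤ C' * x ^ α := by
        have := Real.rpow_nonneg hx α
        gcongr
        exact le_max_left _ _
      have h5 : C * (2 * (S : ℝ)) ^ α ≤ C' * x ^ α := by
        have := Real.rpow_nonneg (show (0 : ℝ) ≤ 2 * S by linarith) α
        calc C * (2 * (S : ℝ)) ^ α ≤ C' * (2 * (S : ℝ)) ^ α := by
              gcongr
              exact le_max_left _ _
          _ ≤ C' * x ^ α := by gcongr
      have h6 : 2 * min x (S : ℝ) ^ α ≤ x ^ α := by
        rw [min_eq_right (by linarith)]
        have h7 : 2 * (S : ℝ) ^ α ≤ 2 ^ α * (S : ℝ) ^ α := by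
          gcongr
          simpa using Real.rpow_le_rpow_of_exponent_le (one_le_two (α := ℝ)) hα
        rw [← Real.mul_rpow (by norm_num) (by linarith)] at h7
        exact h7.trans h3
      have h8 : |F x - F (2 * S)| ≤ |F x| + |F (2 * S)| := abs_sub _ _
      have h9 : C' * (2 * min x (S : ℝ) ^ α) ≤ C' * x ^ α := by gcongr
      linarith
  have hFint := integrable_comp_of_growth hf hf0 hfα hF hC
  obtain ⟨B, hB⟩ := (isCompact_Icc (a := (0 : ℝ)) (b := 2 * S)).exists_bound_of_continuousOn
    hF.continuousOn
  have hFmin : Integrable (fun x => F (min (f x) (2 * S))) P :=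
    integrable_comp_of_bounded hf (G := fun x => F (min x (2 * S))) (by fun_prop) (B := B)
      fun x => hB _ ⟨le_min (hf0 x) (by linarith), min_le_right _ _⟩
  refine ⟨_, _, tendsto_familyAverage_comp_min hf hf0 hev hexp hF (2 * S), ?_, ?_⟩
  · have hlow := (tendsto_familyAverage_comp_min hf hf0 hev hexp hpc S).const_mul (4 * C')
    filter_upwards [hpow, hlow.eventually (lt_mem_nhds hS1)] with d h1 h2
    refine (abs_familyAverage_sub_le (hev d) key).trans ?_
    rw [familyAverage_const_mul, familyAverage_sub]
    have : 4 * C' * familyAverage (ev d) (fun x => x ^ α) ≤ 4 * C' * ∫ x, f x ^ α ∂P := by gcongr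
    linarith
  · rw [← integral_sub hFint hFmin]
    refine (abs_integral_le_integral_abs).trans ?_
    have hSi := hmin_int S (by linarith)
    calc ∫ x, |F (f x) - F (min (f x) (2 * S))| ∂P
        ≤ ∫ x, 4 * C' * (f x ^ α - min (f x) S ^ α) ∂P :=
          integral_mono (hFint.sub hFmin).abs ((hfα.sub hSi).const_mul _)
            fun x => key _ (hf0 x)
      _ ≤ ε := by
          rw [integral_const_mul, integral_sub hfα hSi]
          linarith

end Moments

/-! ### Trace inequalities for compressions of multiplication operators -/

section Compression

open scoped Matrix ComplexConjugate

variable {X ι : Type*} [Fintype ι] {e : ι → X → ℂ}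

/-- The squared modulus of the combination `∑ k, v k * e k x`. -/
noncomputable def sqModulus (e : ι → X → ℂ) (v : ι → ℂ) (x : X) : ℝ :=
  ‖∑ k, v k * e k x‖ ^ 2

lemma sqModulus_nonneg (v : ι → ℂ) (x : X) : 0 ≤ sqModulus e v x := by
  unfold sqModulus; positivity

lemma sqModulus_le (he1 : ∀ k x, ‖e k x‖ = 1) (v : ι → ℂ) (x : X) :
    sqModulus e v x ≤ (∑ k, ‖v k‖) ^ 2 := by
  unfold sqModulus
  gcongr
  refine (norm_sum_le _ _).trans (Finset.sum_le_sum fun k _ => ?_)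
  rw [norm_mul, he1, mul_one]

lemma inner_toLp_conj (e : ι → X → ℂ) (v : EuclideanSpace ℂ ι) (x : X) :
    inner ℂ v (WithLp.toLp 2 fun k => conj (e k x)) = conj (∑ k, v k * e k x) := by
  simp [PiLp.inner_apply, map_sum, mul_comm]

variable [MeasurableSpace X] {P : Measure X}

lemma sqModulus_measurable (he : ∀ k, Measurable (e k)) (v : ι → ℂ) :
    Measurable (sqModulus e v) := by
  unfold sqModulus
  fun_prop

lemma integrable_mul_sqModulus (he : ∀ k, Measurable (e k)) (he1 : ∀ k x, ‖e k x‖ = 1)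
    {f : X → ℝ} (hf : Integrable f P) (v : ι → ℂ) :
    Integrable (fun x => f x * sqModulus e v x) P :=
  hf.mul_bdd (c := (∑ k, ‖v k‖) ^ 2) (sqModulus_measurable he v).aestronglyMeasurable
    (ae_of_all _ fun x => by
      rw [Real.norm_of_nonneg (sqModulus_nonneg v x)]; exact sqModulus_le he1 v x)

lemma star_dotProduct_mulVec_eq_integral (he : ∀ k, Measurable (e k)) (he1 : ∀ k x, ‖e k x‖ = 1)
    {f : X → ℝ} (hf : Integrable f P) {T : Matrix ι ι ℂ}
    (hT : ∀ h k, T h k = ∫ x, (f x : ℂ) * (conj (e h x) * e k x) ∂P) (v : ι → ℂ) :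
    star v ⬝ᵥ (T *ᵥ v) = ((∫ x, f x * sqModulus e v x ∂P : ℝ) : ℂ) := by
  have hprod : ∀ h k, Integrable (fun x => (f x : ℂ) * (conj (e h x) * e k x)) P := fun h k => by
    refine hf.ofReal.mul_bdd (c := 1) ?_ (ae_of_all _ fun x => ?_)
    · have h1 := he h
      have h2 := he k
      exact ((Complex.continuous_conj.measurable.comp h1).mul h2).aestronglyMeasurable
    · rw [norm_mul, RCLike.norm_conj, he1, he1, one_mul]
  rw [← integral_complex_ofReal]
  have hx : ∀ x, ((f x * sqModulus e v x : ℝ) : ℂ) =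
      ∑ h, ∑ k, (conj (v h) * v k) * ((f x : ℂ) * (conj (e h x) * e k x)) := fun x => by
    rw [sqModulus, Complex.ofReal_mul, Complex.ofReal_pow, ← Complex.conj_mul', map_sum,
      Finset.sum_mul_sum, Finset.mul_sum]
    refine Finset.sum_congr rfl fun h _ => ?_
    rw [Finset.mul_sum]
    refine Finset.sum_congr rfl fun k _ => ?_
    rw [map_mul]
    ring
  simp_rw [hx]
  rw [integral_finsetSum _ fun h _ => integrable_finsetSum _ fun k _ => (hprod h k).const_mul _]
  simp only [dotProduct, Matrix.mulVec, Finset.mul_sum]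
  refine Finset.sum_congr rfl fun h _ => ?_
  rw [integral_finsetSum _ fun k _ => (hprod h k).const_mul _]
  refine Finset.sum_congr rfl fun k _ => ?_
  rw [integral_const_mul, ← hT, Pi.star_apply, RCLike.star_def]
  ring

/-- The averaged kernel transform `θ ↦ (1 / |ι|) ∫ f x |∑ k, conj (e k θ) e k x|²`. -/
noncomputable def kernelMean (P : Measure X) (e : ι → X → ℂ) (f : X → ℝ) (θ : X) : ℝ :=
  (1 / (Fintype.card ι : ℝ)) * ∫ x, f x * sqModulus e (fun k => conj (e k θ)) x ∂P

variable [IsProbabilityMeasure P] [DecidableEq ι]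

lemma integral_sqModulus (he : ∀ k, Measurable (e k)) (he1 : ∀ k x, ‖e k x‖ = 1)
    (horth : ∀ h k, ∫ x, conj (e h x) * e k x ∂P = if h = k then 1 else 0) (v : ι → ℂ) :
    ∫ x, sqModulus e v x ∂P = ∑ k, ‖v k‖ ^ 2 := by
  have h := star_dotProduct_mulVec_eq_integral (P := P) he he1 (f := fun _ => 1)
    (integrable_const 1) (T := 1) (fun h k => by simp [horth, Matrix.one_apply]) v
  simp only [Matrix.one_mulVec, one_mul] at h
  rw [← Complex.ofReal_inj, ← h]
  simp [dotProduct, Complex.conj_mul']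

variable {f : X → ℝ} {T : Matrix ι ι ℂ}

omit [IsProbabilityMeasure P] in
lemma eigenvalues_eq_integral (hT' : T.IsHermitian) (he : ∀ k, Measurable (e k))
    (he1 : ∀ k x, ‖e k x‖ = 1) (hf : Integrable f P)
    (hT : ∀ h k, T h k = ∫ x, (f x : ℂ) * (conj (e h x) * e k x) ∂P) (i : ι) :
    hT'.eigenvalues i = ∫ x, f x * sqModulus e (hT'.eigenvectorBasis i) x ∂P := by
  rw [hT'.eigenvalues_eq i]
  erw [star_dotProduct_mulVec_eq_integral he he1 hf hT]
  simp

omit [MeasurableSpace X] in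
lemma sum_sqModulus_eigenvectorBasis (hT' : T.IsHermitian) (he1 : ∀ k x, ‖e k x‖ = 1) (x : X) :
    ∑ i, sqModulus e (hT'.eigenvectorBasis i) x = Fintype.card ι := by
  have h := hT'.eigenvectorBasis.sum_sq_norm_inner_right (WithLp.toLp 2 fun k => conj (e k x))
  simp_rw [inner_toLp_conj, RCLike.norm_conj] at h
  rw [EuclideanSpace.norm_sq_eq] at h
  simpa [sqModulus, he1] using h

omit [IsProbabilityMeasure P] in
lemma sum_eigenvalues_mul_sqModulus (hT' : T.IsHermitian) (he : ∀ k, Measurable (e k))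
    (he1 : ∀ k x, ‖e k x‖ = 1) (hf : Integrable f P)
    (hT : ∀ h k, T h k = ∫ x, (f x : ℂ) * (conj (e h x) * e k x) ∂P) (θ : X) :
    ∑ i, hT'.eigenvalues i * sqModulus e (hT'.eigenvectorBasis i) θ =
      ∫ x, f x * sqModulus e (fun k => conj (e k θ)) x ∂P := by
  rw [← Complex.ofReal_inj, ← star_dotProduct_mulVec_eq_integral he he1 hf hT]
  set w : EuclideanSpace ℂ ι := WithLp.toLp 2 fun k => conj (e k θ) with hw
  have h := hT'.eigenvectorBasis.sum_inner_mul_inner w (WithLp.toLp 2 (T *ᵥ fun k => conj (e k θ)))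
  have h2 : ∀ i, inner ℂ (hT'.eigenvectorBasis i)
      (WithLp.toLp 2 (T *ᵥ fun k => conj (e k θ)) : EuclideanSpace ℂ ι) =
      hT'.eigenvalues i * inner ℂ (hT'.eigenvectorBasis i) w := fun i => by
    have h3 := hT'.mulVec_eigenvectorBasis i
    rw [EuclideanSpace.inner_eq_star_dotProduct, EuclideanSpace.inner_eq_star_dotProduct]
    have h5 : star (hT'.eigenvectorBasis i).ofLp ᵥ* T =
        star ((hT'.eigenvalues i) • (hT'.eigenvectorBasis i).ofLp) := by
      rw [← h3, Matrix.star_mulVec, hT'.eq]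
    rw [dotProduct_comm, Matrix.dotProduct_mulVec, h5, star_smul, smul_dotProduct, dotProduct_comm]
    simp [hw]
  simp_rw [h2] at h
  have h4 : inner ℂ w (WithLp.toLp 2 (T *ᵥ fun k => conj (e k θ)) : EuclideanSpace ℂ ι) =
      star (fun k => conj (e k θ)) ⬝ᵥ (T *ᵥ fun k => conj (e k θ)) := by
    rw [EuclideanSpace.inner_eq_star_dotProduct, dotProduct_comm]
  rw [← h4, ← h, Complex.ofReal_sum]
  refine Finset.sum_congr rfl fun i _ => ?_
  rw [← inner_conj_symm w, hw, inner_toLp_conj, Complex.ofReal_mul, sqModulus, Complex.ofReal_pow,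
    ← Complex.conj_mul', Complex.conj_conj]
  ring

omit [IsProbabilityMeasure P] in
lemma eigenvalues_nonneg_of_symbol (hT' : T.IsHermitian) (he : ∀ k, Measurable (e k))
    (he1 : ∀ k x, ‖e k x‖ = 1) (hf : Integrable f P) (hf0 : ∀ x, 0 ≤ f x)
    (hT : ∀ h k, T h k = ∫ x, (f x : ℂ) * (conj (e h x) * e k x) ∂P) (i : ι) :
    0 ≤ hT'.eigenvalues i := by
  rw [eigenvalues_eq_integral hT' he he1 hf hT]
  exact integral_nonneg fun x => mul_nonneg (hf0 x) (sqModulus_nonneg _ _)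

lemma integral_sqModulus_eigenvectorBasis (hT' : T.IsHermitian) (he : ∀ k, Measurable (e k))
    (he1 : ∀ k x, ‖e k x‖ = 1)
    (horth : ∀ h k, ∫ x, conj (e h x) * e k x ∂P = if h = k then 1 else 0) (i : ι) :
    ∫ x, sqModulus e (hT'.eigenvectorBasis i) x ∂P = 1 := by
  rw [integral_sqModulus he he1 horth, ← EuclideanSpace.norm_sq_eq,
    hT'.eigenvectorBasis.orthonormal.1 i, one_pow]

omit [DecidableEq ι] in
lemma integrable_sqModulus (he : ∀ k, Measurable (e k)) (he1 : ∀ k x, ‖e k x‖ = 1) (v : ι → ℂ) :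
    Integrable (sqModulus e v) P := by
  simpa using integrable_mul_sqModulus (P := P) he he1 (integrable_const (1 : ℝ)) v

/-- Berezin's upper bound: for `G` with supporting lines on `[0, ∞)`, the normalised trace of
`G (T)` is at most the integral of `G ∘ f`. -/
theorem familyAverage_eigenvalues_le [Nonempty ι] (hT' : T.IsHermitian) (he : ∀ k, Measurable (e k))
    (he1 : ∀ k x, ‖e k x‖ = 1)
    (horth : ∀ h k, ∫ x, conj (e h x) * e k x ∂P = if h = k then 1 else 0)
    (hf : Integrable f P) (hf0 : ∀ x, 0 ≤ f x)
    (hT : ∀ h k, T h k = ∫ x, (f x : ℂ) * (conj (e h x) * e k x) ∂P)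
    {G c : ℝ → ℝ} (hG : ∀ s t, 0 ≤ s → 0 ≤ t → G s + c s * (t - s) ≤ G t)
    (hGf : Integrable (fun x => G (f x)) P) :
    familyAverage hT'.eigenvalues G ≤ ∫ x, G (f x) ∂P := by
  have hD : (0 : ℝ) < Fintype.card ι := by exact_mod_cast Fintype.card_pos
  set q : ι → X → ℝ := fun i => sqModulus e (hT'.eigenvectorBasis i) with hq
  have h1 : ∀ i, G (hT'.eigenvalues i) ≤ ∫ x, G (f x) * q i x ∂P := fun i => by
    set s := hT'.eigenvalues i with hs
    have hs0 : 0 ≤ s := eigenvalues_nonneg_of_symbol hT' he he1 hf hf0 hT i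
    have i1 : Integrable (fun x => f x * q i x) P := integrable_mul_sqModulus he he1 hf _
    have i2 : Integrable (q i) P := integrable_sqModulus he he1 _
    have i3 : Integrable (fun x => G (f x) * q i x) P := integrable_mul_sqModulus he he1 hGf _
    calc G s = ∫ x, ((G s - c s * s) * q i x + c s * (f x * q i x)) ∂P := by
          rw [integral_add (i2.const_mul _) (i1.const_mul _), integral_const_mul,
            integral_const_mul, ← eigenvalues_eq_integral hT' he he1 hf hT,
            integral_sqModulus_eigenvectorBasis hT' he he1 horth]
          ring
      _ ≤ ∫ x, G (f x) * q i x ∂P := by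
          refine integral_mono ((i2.const_mul _).add (i1.const_mul _)) i3 fun x => ?_
          have := mul_le_mul_of_nonneg_right (hG s (f x) hs0 (hf0 x))
            (sqModulus_nonneg (e := e) (hT'.eigenvectorBasis i) x)
          simp only [hq]
          linarith
  calc familyAverage hT'.eigenvalues G
      ≤ (1 / (Fintype.card ι : ℝ)) * ∑ i, ∫ x, G (f x) * q i x ∂P := by
        unfold familyAverage
        gcongr with i
        exact h1 i
    _ = (1 / (Fintype.card ι : ℝ)) * ∫ x, G (f x) * Fintype.card ι ∂P := by
        rw [← integral_finsetSum _ fun i _ => integrable_mul_sqModulus he he1 hGf _]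
        simp_rw [← Finset.mul_sum, sum_sqModulus_eigenvectorBasis hT' he1]
    _ = ∫ x, G (f x) ∂P := by
        rw [integral_mul_const]
        field_simp

/-- Berezin's lower bound: for `G` with supporting lines on `[0, ∞)`, the normalised trace of
`G (T)` is at least the integral of `G` along the kernel mean of `f`. -/
theorem le_familyAverage_eigenvalues [Nonempty ι] (hT' : T.IsHermitian) (he : ∀ k, Measurable (e k))
    (he1 : ∀ k x, ‖e k x‖ = 1)
    (horth : ∀ h k, ∫ x, conj (e h x) * e k x ∂P = if h = k then 1 else 0)
    (hf : Integrable f P) (hf0 : ∀ x, 0 ≤ f x)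
    (hT : ∀ h k, T h k = ∫ x, (f x : ℂ) * (conj (e h x) * e k x) ∂P)
    {G c : ℝ → ℝ} (hG : ∀ s t, 0 ≤ s → 0 ≤ t → G s + c s * (t - s) ≤ G t)
    (hGf : Integrable (fun θ => G (kernelMean P e f θ)) P) :
    ∫ θ, G (kernelMean P e f θ) ∂P ≤ familyAverage hT'.eigenvalues G := by
  have hD : (0 : ℝ) < Fintype.card ι := by exact_mod_cast Fintype.card_pos
  set q : ι → X → ℝ := fun i => sqModulus e (hT'.eigenvectorBasis i) with hq
  have hq_int : ∀ i, Integrable (q i) P := fun i => integrable_sqModulus he he1 _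
  have h1 : ∀ θ, G (kernelMean P e f θ) ≤
      (1 / (Fintype.card ι : ℝ)) * ∑ i, G (hT'.eigenvalues i) * q i θ := fun θ => by
    set s := kernelMean P e f θ with hs
    have hs0 : 0 ≤ s := mul_nonneg (by positivity)
      (integral_nonneg fun x => mul_nonneg (hf0 x) (sqModulus_nonneg _ _))
    have hsum : ∑ i, (G s + c s * (hT'.eigenvalues i - s)) * q i θ ≤
        ∑ i, G (hT'.eigenvalues i) * q i θ := by
      refine Finset.sum_le_sum fun i _ => mul_le_mul_of_nonneg_right ?_ (sqModulus_nonneg _ _)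
      exact hG s _ hs0 (eigenvalues_nonneg_of_symbol hT' he he1 hf hf0 hT i)
    have hS1 : ∑ i, hT'.eigenvalues i * q i θ = Fintype.card ι * s := by
      rw [sum_eigenvalues_mul_sqModulus hT' he he1 hf hT, hs, kernelMean]
      field_simp
    have hS2 : ∑ i, q i θ = Fintype.card ι := sum_sqModulus_eigenvectorBasis hT' he1 θ
    have hS3 : ∑ i, (G s + c s * (hT'.eigenvalues i - s)) * q i θ =
        (G s - c s * s) * ∑ i, q i θ + c s * ∑ i, hT'.eigenvalues i * q i θ := by
      rw [Finset.mul_sum, Finset.mul_sum, ← Finset.sum_add_distrib]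
      exact Finset.sum_congr rfl fun i _ => by ring
    rw [hS3, hS1, hS2] at hsum
    rw [one_div, inv_mul_eq_div, le_div_iff₀ hD]
    linarith
  calc ∫ θ, G (kernelMean P e f θ) ∂P
      ≤ ∫ θ, (1 / (Fintype.card ι : ℝ)) * ∑ i, G (hT'.eigenvalues i) * q i θ ∂P :=
        integral_mono hGf ((integrable_finsetSum _ fun i _ => (hq_int i).const_mul _).const_mul _)
          h1
    _ = familyAverage hT'.eigenvalues G := by
        rw [integral_const_mul, integral_finsetSum _ fun i _ => (hq_int i).const_mul _,
          familyAverage]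
        simp_rw [integral_const_mul, hq,
          integral_sqModulus_eigenvectorBasis hT' he he1 horth, mul_one]

end Compression

/-! ### Mean convergence of kernel means -/

section KernelMean

open scoped ComplexConjugate

variable {X ι : Type*} [Fintype ι] {e : ι → X → ℂ}

lemma sqModulus_conj_comm (x θ : X) :
    sqModulus e (fun k => conj (e k θ)) x = sqModulus e (fun k => conj (e k x)) θ := by
  unfold sqModulus
  rw [← RCLike.norm_conj, map_sum]
  simp [mul_comm]

variable [MeasurableSpace X] {P : Measure X}

lemma measurable_sqModulus_conj (he : ∀ k, Measurable (e k)) :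
    Measurable fun z : X × X => sqModulus e (fun k => conj (e k z.2)) z.1 := by
  unfold sqModulus
  refine (Measurable.norm ?_).pow_const 2
  refine Finset.measurable_sum _ fun k _ => ?_
  exact (Complex.continuous_conj.measurable.comp ((he k).comp measurable_snd)).mul
    ((he k).comp measurable_fst)

/-- The kernel mean of a complex-valued function. -/
noncomputable def complexKernelMean (P : Measure X) (e : ι → X → ℂ) (g : X → ℂ) (θ : X) : ℂ :=
  (1 / (Fintype.card ι : ℂ)) * ∫ x, g x * sqModulus e (fun k => conj (e k θ)) x ∂P

lemma complexKernelMean_ofReal (f : X → ℝ) (θ : X) :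
    complexKernelMean P e (fun x => (f x : ℂ)) θ = kernelMean P e f θ := by
  simp only [complexKernelMean, kernelMean, ← Complex.ofReal_mul, integral_complex_ofReal]
  push_cast
  rfl

lemma integrable_mul_sqModulus_complex (he : ∀ k, Measurable (e k)) (he1 : ∀ k x, ‖e k x‖ = 1)
    {g : X → ℂ} (hg : Integrable g P) (v : ι → ℂ) :
    Integrable (fun x => g x * sqModulus e v x) P :=
  hg.mul_bdd (c := (∑ k, ‖v k‖) ^ 2)
    (Complex.measurable_ofReal.comp (sqModulus_measurable he v)).aestronglyMeasurable
    (ae_of_all _ fun x => by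
      rw [Complex.norm_real, Real.norm_of_nonneg (sqModulus_nonneg v x)]
      exact sqModulus_le he1 v x)

lemma complexKernelMean_add (he : ∀ k, Measurable (e k)) (he1 : ∀ k x, ‖e k x‖ = 1)
    {g h : X → ℂ} (hg : Integrable g P) (hh : Integrable h P) (θ : X) :
    complexKernelMean P e (fun x => g x + h x) θ =
      complexKernelMean P e g θ + complexKernelMean P e h θ := by
  simp only [complexKernelMean, add_mul]
  rw [integral_add (integrable_mul_sqModulus_complex he he1 hg _)
    (integrable_mul_sqModulus_complex he he1 hh _), mul_add]

lemma complexKernelMean_const_mul (c : ℂ) (g : X → ℂ) (θ : X) :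
    complexKernelMean P e (fun x => c * g x) θ = c * complexKernelMean P e g θ := by
  simp only [complexKernelMean, mul_assoc, integral_const_mul]
  ring

variable [IsProbabilityMeasure P]

lemma integrable_prod_mul_sqModulus (he : ∀ k, Measurable (e k)) (he1 : ∀ k x, ‖e k x‖ = 1)
    {g : X → ℂ} (hg : Integrable g P) :
    Integrable (fun z : X × X => g z.1 * sqModulus e (fun k => conj (e k z.2)) z.1)
      (P.prod P) :=
  (hg.comp_fst P).mul_bdd (c := (Fintype.card ι : ℝ) ^ 2)
    (Complex.measurable_ofReal.comp (measurable_sqModulus_conj he)).aestronglyMeasurable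
    (ae_of_all _ fun z => by
      rw [Complex.norm_real, Real.norm_of_nonneg (sqModulus_nonneg _ _)]
      refine (sqModulus_le he1 _ _).trans (le_of_eq ?_)
      simp [he1])

lemma integrable_complexKernelMean (he : ∀ k, Measurable (e k)) (he1 : ∀ k x, ‖e k x‖ = 1)
    {g : X → ℂ} (hg : Integrable g P) : Integrable (complexKernelMean P e g) P :=
  (integrable_prod_mul_sqModulus he he1 hg).integral_prod_right.const_mul _

lemma integral_norm_complexKernelMean_le [Nonempty ι] [DecidableEq ι]
    (he : ∀ k, Measurable (e k)) (he1 : ∀ k x, ‖e k x‖ = 1)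
    (horth : ∀ h k, ∫ x, conj (e h x) * e k x ∂P = if h = k then 1 else 0)
    {g : X → ℂ} (hg : Integrable g P) :
    ∫ θ, ‖complexKernelMean P e g θ‖ ∂P ≤ ∫ x, ‖g x‖ ∂P := by
  have hD : (0 : ℝ) < Fintype.card ι := by exact_mod_cast Fintype.card_pos
  have hprod := (integrable_prod_mul_sqModulus he he1 hg).norm
  calc ∫ θ, ‖complexKernelMean P e g θ‖ ∂P
      ≤ ∫ θ, (1 / (Fintype.card ι : ℝ)) *
          ∫ x, ‖g x * sqModulus e (fun k => conj (e k θ)) x‖ ∂P ∂P := by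
        refine integral_mono (integrable_complexKernelMean he he1 hg).norm
          (hprod.integral_prod_right.const_mul _) fun θ => ?_
        simp only [complexKernelMean, norm_mul, norm_div, norm_one, Complex.norm_natCast]
        gcongr
        refine (norm_integral_le_integral_norm _).trans (le_of_eq ?_)
        simp only [norm_mul]
    _ = (1 / (Fintype.card ι : ℝ)) *
          ∫ x, ∫ θ, ‖g x * sqModulus e (fun k => conj (e k θ)) x‖ ∂P ∂P := by
        rw [integral_const_mul, ← integral_integral_swap hprod]
    _ = (1 / (Fintype.card ι : ℝ)) * ∫ x, ‖g x‖ * Fintype.card ι ∂P := by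
        congr 2
        ext x
        simp_rw [norm_mul, Complex.norm_real, Real.norm_of_nonneg (sqModulus_nonneg _ _),
          sqModulus_conj_comm x, integral_const_mul, integral_sqModulus he he1 horth,
          RCLike.norm_conj, he1]
        simp
    _ = ∫ x, ‖g x‖ ∂P := by
        rw [integral_mul_const]
        field_simp

end KernelMean

/-! ### Characters on the cube `[-π, π]ᵐ` -/

section Cube

open scoped ComplexConjugate

variable {m : ℕ}

/-- The cube `[-π, π]ᵐ`. -/
def piCube (m : ℕ) : Set (Fin m → ℝ) := Set.univ.pi fun _ : Fin m => Set.Icc (-π) π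

/-- Normalised Lebesgue measure on the cube `[-π, π]ᵐ`. -/
noncomputable def cubeMeasure (m : ℕ) : Measure (Fin m → ℝ) :=
  ENNReal.ofReal ((1 / (2 * π)) ^ m) • volume.restrict (piCube m)

lemma measurableSet_piCube : MeasurableSet (piCube m) :=
  MeasurableSet.univ_pi fun _ => measurableSet_Icc

lemma integral_cubeMeasure {E : Type*} [NormedAddCommGroup E] [NormedSpace ℝ E]
    (g : (Fin m → ℝ) → E) :
    ∫ φ, g φ ∂cubeMeasure m = ((1 / (2 * π)) ^ m : ℝ) • ∫ φ in piCube m, g φ := by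
  rw [cubeMeasure, integral_smul_measure, ENNReal.toReal_ofReal (by positivity)]

lemma integrable_cubeMeasure_iff {E : Type*} [NormedAddCommGroup E] {g : (Fin m → ℝ) → E} :
    Integrable g (cubeMeasure m) ↔ IntegrableOn g (piCube m) := by
  rw [cubeMeasure, integrable_smul_measure _ ENNReal.ofReal_ne_top, IntegrableOn]
  have : 0 < (1 / (2 * π)) ^ m := by positivity
  simpa using this

instance : IsProbabilityMeasure (cubeMeasure m) := ⟨by
  have h : volume (piCube m) = ENNReal.ofReal ((2 * π) ^ m) := by
    rw [piCube, volume_pi_pi]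
    simp only [Real.volume_Icc, Finset.prod_const, Finset.card_univ, Fintype.card_fin]
    rw [← ENNReal.ofReal_pow (by linarith [Real.pi_pos])]
    ring_nf
  rw [cubeMeasure, Measure.smul_apply, Measure.restrict_apply_univ, h, smul_eq_mul,
    ← ENNReal.ofReal_mul (by positivity), ← mul_pow, one_div_mul_cancel (by positivity)]
  simp⟩

lemma ae_mem_pi_Ioc :
    ∀ᵐ φ ∂cubeMeasure m, φ ∈ Set.univ.pi fun _ : Fin m => Set.Ioc (-π) π := by
  refine Measure.ae_smul_measure ?_ _
  have h : (Set.univ.pi fun _ : Fin m => Set.Ioc (-π) π) =ᵐ[volume] piCube m :=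
    Measure.univ_pi_Ioc_ae_eq_Icc (μ := fun _ : Fin m => (volume : Measure ℝ))
      (f := fun _ => -π) (g := fun _ => π) |>.trans (by rw [piCube, Set.pi_univ_Icc]; rfl)
  rw [← Measure.restrict_congr_set h]
  exact ae_restrict_mem (MeasurableSet.univ_pi fun _ => measurableSet_Ioc)

/-- The character `φ ↦ exp (i n · φ)`. -/
noncomputable def character (n : Fin m → ℤ) (φ : Fin m → ℝ) : ℂ :=
  Complex.exp (Complex.I * ∑ j, (n j : ℂ) * φ j)

lemma continuous_character (n : Fin m → ℤ) : Continuous (character n) := by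
  unfold character
  fun_prop

lemma norm_character (n : Fin m → ℤ) (φ : Fin m → ℝ) : ‖character n φ‖ = 1 := by
  have h : Complex.I * ∑ j, (n j : ℂ) * φ j = ((∑ j, (n j : ℝ) * φ j : ℝ) : ℂ) * Complex.I := by
    push_cast
    ring
  rw [character, h, Complex.norm_exp_ofReal_mul_I]

lemma character_add (n l : Fin m → ℤ) (φ : Fin m → ℝ) :
    character (n + l) φ = character n φ * character l φ := by
  simp only [character, ← Complex.exp_add, ← mul_add, ← Finset.sum_add_distrib, Pi.add_apply,
    Int.cast_add, add_mul]

lemma conj_character (n : Fin m → ℤ) (φ : Fin m → ℝ) :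
    conj (character n φ) = character (-n) φ := by
  simp [character, ← Complex.exp_conj, map_sum]

lemma integrable_character (n : Fin m → ℤ) : Integrable (character n) (cubeMeasure m) :=
  Integrable.of_bound (continuous_character n).aestronglyMeasurable 1
    (ae_of_all _ fun φ => (norm_character n φ).le)

lemma integral_Icc_exp (n : ℤ) :
    ∫ x in Set.Icc (-π) π, Complex.exp (Complex.I * (n * (x : ℝ))) =
      if n = 0 then (2 * π : ℂ) else 0 := by
  rw [integral_Icc_eq_integral_Ioc, ← intervalIntegral.integral_of_le (by linarith [Real.pi_pos])]
  split_ifs with hn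
  · subst hn
    simp
    ring
  · have hc : Complex.I * n ≠ 0 := by simp [hn]
    simp_rw [← mul_assoc]
    rw [integral_exp_mul_complex hc]
    have h : Complex.exp (Complex.I * n * π) = Complex.exp (Complex.I * n * ((-π : ℝ) : ℂ)) := by
      rw [Complex.exp_eq_exp_iff_exists_int]
      exact ⟨n, by push_cast; ring⟩
    rw [h, sub_self, zero_div]

lemma integral_character (n : Fin m → ℤ) :
    ∫ φ, character n φ ∂cubeMeasure m = if n = 0 then 1 else 0 := by
  have h : ∀ φ : Fin m → ℝ, character n φ = ∏ j, Complex.exp (Complex.I * (n j * (φ j : ℝ))) :=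
    fun φ => by rw [character, Finset.mul_sum, Complex.exp_sum]
  rw [integral_cubeMeasure, piCube, volume_pi, Measure.restrict_pi_pi]
  simp_rw [h]
  rw [integral_fintype_prod_eq_prod (fun j (x : ℝ) => Complex.exp (Complex.I * (n j * (x : ℝ))))]
  simp_rw [integral_Icc_exp]
  split_ifs with hn
  · subst hn
    have : (π : ℂ) ≠ 0 := by exact_mod_cast Real.pi_ne_zero
    simp only [Pi.zero_apply, if_true, Finset.prod_const, Finset.card_univ, Fintype.card_fin,
      Complex.real_smul]
    push_cast
    rw [← mul_pow, one_div_mul_cancel (by simp [this]), one_pow]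
  · obtain ⟨j, hj⟩ := Function.ne_iff.1 hn
    rw [Finset.prod_eq_zero (Finset.mem_univ j) (if_neg hj), smul_zero]

/-- Trigonometric polynomials are dense in `L¹` of the cube. -/
theorem exists_span_character_near {g : (Fin m → ℝ) → ℂ} (hg : Integrable g (cubeMeasure m))
    {ε : ℝ} (hε : 0 < ε) :
    ∃ p ∈ Submodule.span ℂ (Set.range (character (m := m))),
      ∫ φ, ‖g φ - p φ‖ ∂cubeMeasure m ≤ ε := by
  set q : (Fin m → ℝ) → UnitAddTorus (Fin m) := fun φ j => ((φ j / (2 * π) : ℝ) : UnitAddCircle)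
    with hq
  set r : UnitAddTorus (Fin m) → (Fin m → ℝ) :=
    fun x j => 2 * π * (AddCircle.measurableEquivIoc (1 : ℝ) (-1 / 2) (x j) : ℝ) with hr
  have hqm : Measurable q := by
    refine measurable_pi_lambda _ fun j => AddCircle.measurable_mk'.comp ?_
    fun_prop
  have hrm : Measurable r := by
    refine measurable_pi_lambda _ fun j => Measurable.const_mul ?_ _
    exact measurable_subtype_coe.comp
      ((AddCircle.measurableEquivIoc (1 : ℝ) (-1 / 2)).measurable.comp (measurable_pi_apply j))
  have hrq : ∀ᵐ φ ∂cubeMeasure m, r (q φ) = φ := by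
    filter_upwards [ae_mem_pi_Ioc] with φ hφ
    ext j
    have hj := hφ j (Set.mem_univ j)
    have hmem : φ j / (2 * π) ∈ Set.Ioc (-1 / 2 : ℝ) (-1 / 2 + 1) := by
      have := Real.pi_pos
      constructor
      · rw [lt_div_iff₀ (by positivity)]; linarith [hj.1]
      · rw [div_le_iff₀ (by positivity)]; linarith [hj.2]
    have h := AddCircle.equivIoc_coe_of_mem (p := (1 : ℝ)) (a := -1 / 2) hmem
    have h' : (AddCircle.measurableEquivIoc (1 : ℝ) (-1 / 2) (q φ j) : ℝ) = φ j / (2 * π) := by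
      exact h
    simp only [hr, h']
    field_simp
  set ν := (cubeMeasure m).map q with hν
  have : IsProbabilityMeasure ν := Measure.isProbabilityMeasure_map hqm.aemeasurable
  have hνr : ν.map r = cubeMeasure m := by
    rw [hν, Measure.map_map hrm hqm, Measure.map_congr (f := r ∘ q) (g := id) hrq, Measure.map_id]
  have hgr : Integrable (g ∘ r) ν := by
    rw [← integrable_map_measure (by rw [hνr]; exact hg.aestronglyMeasurable) hrm.aemeasurable, hνr]
    exact hg
  obtain ⟨b, hb, hbi⟩ := hgr.exists_boundedContinuous_integral_sub_le (half_pos hε)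
  have hb_mem : b.toContinuousMap ∈
      (Submodule.span ℂ (Set.range (UnitAddTorus.mFourier (d := Fin m)))).topologicalClosure := by
    rw [UnitAddTorus.span_mFourier_closure_eq_top]
    trivial
  obtain ⟨p, hp, hpb⟩ := Metric.mem_closure_iff.1 hb_mem (ε / 2) (half_pos hε)
  refine ⟨fun φ => p (q φ), ?_, ?_⟩
  · clear hpb
    induction hp using Submodule.span_induction with
    | mem p hp =>
      obtain ⟨n, rfl⟩ := hp
      refine Submodule.subset_span ⟨n, ?_⟩
      ext φ
      rw [character, Finset.mul_sum, Complex.exp_sum]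
      simp only [UnitAddTorus.mFourier, ContinuousMap.coe_mk, hq, fourier_coe_apply]
      refine Finset.prod_congr rfl fun j _ => ?_
      congr 1
      have : (π : ℂ) ≠ 0 := by exact_mod_cast Real.pi_ne_zero
      push_cast
      field_simp
    | zero => exact Submodule.zero_mem _
    | add p₁ p₂ _ _ h₁ h₂ => exact Submodule.add_mem _ h₁ h₂
    | smul c p _ h => exact Submodule.smul_mem _ c h
  · have hpi : Integrable (fun x => p x) ν :=
      Integrable.of_bound p.continuous.aestronglyMeasurable ‖p‖
        (ae_of_all _ fun x => p.norm_coe_le_norm x)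
    calc ∫ φ, ‖g φ - p (q φ)‖ ∂cubeMeasure m
        = ∫ φ, ‖(g ∘ r) (q φ) - p (q φ)‖ ∂cubeMeasure m := by
          refine integral_congr_ae ?_
          filter_upwards [hrq] with φ hφ
          simp only [Function.comp_apply, hφ]
      _ = ∫ x, ‖(g ∘ r) x - p x‖ ∂ν := by
          rw [hν, integral_map hqm.aemeasurable]
          exact (hgr.sub hpi).norm.aestronglyMeasurable
      _ ≤ ∫ x, (‖(g ∘ r) x - b x‖ + ε / 2) ∂ν := by
          refine integral_mono (hgr.sub hpi).norm ((hgr.sub hbi).norm.add (integrable_const _))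
            fun x => ?_
          have h1 : ‖b x - p x‖ ≤ ε / 2 := by
            rw [← dist_eq_norm]
            exact (ContinuousMap.dist_apply_le_dist (f := b.toContinuousMap) (g := p) x).trans
              hpb.le
          exact (norm_sub_le_norm_sub_add_norm_sub _ (b x) _).trans (by gcongr)
      _ ≤ ε := by
          have h := integral_add (hgr.sub hbi).norm (integrable_const (μ := ν) (ε / 2))
          simp only [Pi.sub_apply] at h
          rw [h]
          simp only [integral_const, probReal_univ, one_smul]
          linarith

end Cube

/-! ### Fejér means on the cube -/

section Fejer

open scoped ComplexConjugate

variable {m : ℕ}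

/-- The characters indexed by the multi-indices `0 ≤ h j < d j`. -/
noncomputable def boxCharacter (d : Fin m → ℕ) (h : (j : Fin m) → Fin (d j)) :
    (Fin m → ℝ) → ℂ :=
  character fun j => ((h j : ℕ) : ℤ)

lemma measurable_boxCharacter (d : Fin m → ℕ) (h : (j : Fin m) → Fin (d j)) :
    Measurable (boxCharacter d h) :=
  (continuous_character _).measurable

lemma norm_boxCharacter (d : Fin m → ℕ) (h : (j : Fin m) → Fin (d j)) (φ : Fin m → ℝ) :
    ‖boxCharacter d h φ‖ = 1 :=
  norm_character _ _

lemma integral_conj_boxCharacter_mul (d : Fin m → ℕ) (h k : (j : Fin m) → Fin (d j)) :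
    ∫ φ, conj (boxCharacter d h φ) * boxCharacter d k φ ∂cubeMeasure m =
      if h = k then 1 else 0 := by
  simp only [boxCharacter, conj_character, ← character_add, integral_character]
  refine if_congr ?_ rfl rfl
  rw [neg_add_eq_zero]
  simp only [funext_iff, Nat.cast_inj, Fin.ext_iff]

lemma tendsto_apply_atTop (j : Fin m) : Tendsto (fun d : Fin m → ℕ => d j) atTop atTop :=
  tendsto_atTop.2 fun N => (eventually_ge_atTop fun _ => N).mono fun _ h => h j

lemma eventually_nonempty_box : ∀ᶠ d : Fin m → ℕ in atTop, Nonempty ((j : Fin m) → Fin (d j)) :=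
  (eventually_ge_atTop fun _ => 1).mono fun _ h => ⟨fun j => ⟨0, h j⟩⟩

lemma le_sum_shift (l : ℤ) (n : ℕ) :
    (n : ℝ) - |(l : ℝ)| ≤ ∑ a : Fin n, ∑ b : Fin n,
      if l + ((b : ℕ) : ℤ) = ((a : ℕ) : ℤ) then (1 : ℝ) else 0 := by
  have hsub : Finset.Ico (-l).toNat (n - l.toNat) ⊆
      (Finset.range n).filter fun b : ℕ => 0 ≤ l + b ∧ l + b < n := by
    intro b hb
    simp only [Finset.mem_Ico, Finset.mem_filter, Finset.mem_range] at hb ⊢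
    omega
  have hcard := Finset.card_le_card hsub
  rw [Nat.card_Ico] at hcard
  have h1 : ((n : ℤ) - |l| : ℤ) ≤
      (((Finset.range n).filter fun b : ℕ => 0 ≤ l + b ∧ l + b < n).card : ℤ) := by
    rcases abs_cases l with h | h <;> omega
  have h2 : (n : ℝ) - |(l : ℝ)| ≤
      (((Finset.range n).filter fun b : ℕ => 0 ≤ l + b ∧ l + b < n).card : ℝ) := by
    exact_mod_cast h1
  refine h2.trans ?_
  rw [Finset.sum_comm, Finset.card_filter, Nat.cast_sum,
    ← Fin.sum_univ_eq_sum_range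
      (fun b : ℕ => (((if 0 ≤ l + b ∧ l + b < n then 1 else 0 : ℕ)) : ℝ)) n]
  refine Finset.sum_le_sum fun b _ => ?_
  split_ifs with hb
  · have hlt : (l + ((b : ℕ) : ℤ)).toNat < n := by omega
    have heq : l + ((b : ℕ) : ℤ) = (((⟨_, hlt⟩ : Fin n) : ℕ) : ℤ) := by
      simp only
      omega
    calc ((1 : ℕ) : ℝ) = if l + ((b : ℕ) : ℤ) = (((⟨_, hlt⟩ : Fin n) : ℕ) : ℤ)
          then (1 : ℝ) else 0 := by rw [if_pos heq, Nat.cast_one]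
      _ ≤ _ := Finset.single_le_sum
          (f := fun a : Fin n => if l + ((b : ℕ) : ℤ) = ((a : ℕ) : ℤ) then (1 : ℝ) else 0)
          (fun a _ => by positivity) (Finset.mem_univ _)
  · rw [Nat.cast_zero]
    exact Finset.sum_nonneg fun a _ => by positivity

lemma sum_shift_le (l : ℤ) (n : ℕ) :
    ∑ a : Fin n, ∑ b : Fin n, (if l + ((b : ℕ) : ℤ) = ((a : ℕ) : ℤ) then (1 : ℝ) else 0) ≤ n := by
  calc ∑ a : Fin n, ∑ b : Fin n, (if l + ((b : ℕ) : ℤ) = ((a : ℕ) : ℤ) then (1 : ℝ) else 0)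
      ≤ ∑ _a : Fin n, (1 : ℝ) := by
        refine Finset.sum_le_sum fun a _ => ?_
        rw [Finset.sum_boole]
        have : (Finset.univ.filter fun b : Fin n => l + ((b : ℕ) : ℤ) = ((a : ℕ) : ℤ)).card ≤ 1 :=
          Finset.card_le_one.2 fun b hb b' hb' => by
            simp only [Finset.mem_filter] at hb hb'
            ext
            omega
        exact_mod_cast this
    _ = n := by simp

lemma tendsto_shift_ratio (l : ℤ) :
    Tendsto (fun n : ℕ => (1 / (n : ℝ)) * ∑ a : Fin n, ∑ b : Fin n,
      if l + ((b : ℕ) : ℤ) = ((a : ℕ) : ℤ) then (1 : ℝ) else 0) atTop (nhds 1) := by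
  have hlow : Tendsto (fun n : ℕ => 1 - |(l : ℝ)| / n) atTop (nhds 1) := by
    simpa using tendsto_const_nhds.sub (tendsto_const_div_atTop_nhds_zero_nat |(l : ℝ)|)
  refine tendsto_of_tendsto_of_tendsto_of_le_of_le' hlow tendsto_const_nhds ?_ ?_ <;>
    filter_upwards [eventually_gt_atTop 0] with n hn <;>
    have hn' : (0 : ℝ) < n := by exact_mod_cast hn
  · rw [one_div, inv_mul_eq_div, le_div_iff₀ hn', sub_mul, div_mul_cancel₀ _ hn'.ne', one_mul]
    exact le_sum_shift l n
  · rw [one_div, inv_mul_eq_div, div_le_iff₀ hn', one_mul]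
    exact sum_shift_le l n

/-- The Fourier multiplier of the Fejér mean. -/
noncomputable def fejerMultiplier (l : Fin m → ℤ) (d : Fin m → ℕ) : ℝ :=
  ∏ j, (1 / (d j : ℝ)) * ∑ a : Fin (d j), ∑ b : Fin (d j),
    if l j + ((b : ℕ) : ℤ) = ((a : ℕ) : ℤ) then (1 : ℝ) else 0

lemma tendsto_fejerMultiplier (l : Fin m → ℤ) :
    Tendsto (fejerMultiplier l) atTop (nhds 1) := by
  have h := tendsto_finsetProd (Finset.univ : Finset (Fin m)) fun j _ =>
    (tendsto_shift_ratio (l j)).comp (tendsto_apply_atTop j)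
  rw [Finset.prod_const_one] at h
  exact h

lemma fejerMultiplier_eq (l : Fin m → ℤ) (d : Fin m → ℕ) :
    fejerMultiplier l d = (1 / (Fintype.card ((j : Fin m) → Fin (d j)) : ℝ)) *
      ∑ h : (j : Fin m) → Fin (d j), ∑ k : (j : Fin m) → Fin (d j),
        if (l + fun j => ((k j : ℕ) : ℤ)) = (fun j => ((h j : ℕ) : ℤ)) then (1 : ℝ) else 0 := by
  rw [fejerMultiplier, Finset.prod_mul_distrib, Fintype.card_pi, Finset.prod_div_distrib,
    Finset.prod_const_one, Nat.cast_prod]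
  simp only [Fintype.card_fin]
  congr 1
  rw [Fintype.prod_sum]
  refine Finset.sum_congr rfl fun h _ => ?_
  rw [Fintype.prod_sum]
  refine Finset.sum_congr rfl fun k _ => ?_
  rw [Finset.prod_ite_zero]
  simp [funext_iff]

lemma complexKernelMean_character (l : Fin m → ℤ) (d : Fin m → ℕ) (θ : Fin m → ℝ) :
    complexKernelMean (cubeMeasure m) (boxCharacter d) (character l) θ =
      fejerMultiplier l d * character l θ := by
  have hx : ∀ x, character l x * (sqModulus (boxCharacter d)
      (fun k => conj (boxCharacter d k θ)) x : ℂ) =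
      ∑ h, ∑ k, (boxCharacter d h θ * conj (boxCharacter d k θ)) *
        character (l + (-(fun j => ((h j : ℕ) : ℤ)) + fun j => ((k j : ℕ) : ℤ))) x := fun x => by
    rw [sqModulus, Complex.ofReal_pow, ← Complex.conj_mul', map_sum,
      Finset.sum_mul_sum, Finset.mul_sum]
    refine Finset.sum_congr rfl fun h _ => ?_
    rw [Finset.mul_sum]
    refine Finset.sum_congr rfl fun k _ => ?_
    rw [map_mul, Complex.conj_conj, character_add, character_add, ← conj_character]
    simp only [boxCharacter]
    ring
  rw [complexKernelMean]
  simp_rw [hx]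
  rw [integral_finsetSum _ fun h _ => integrable_finsetSum _ fun k _ =>
    (integrable_character _).const_mul _, fejerMultiplier_eq]
  push_cast
  rw [mul_assoc, Finset.sum_mul]
  congr 1
  refine Finset.sum_congr rfl fun h _ => ?_
  rw [integral_finsetSum _ fun k _ => (integrable_character _).const_mul _, Finset.sum_mul]
  refine Finset.sum_congr rfl fun k _ => ?_
  rw [integral_const_mul, integral_character]
  have hiff : l + (-(fun j => ((h j : ℕ) : ℤ)) + fun j => ((k j : ℕ) : ℤ)) = 0 ↔
      (l + fun j => ((k j : ℕ) : ℤ)) = fun j => ((h j : ℕ) : ℤ) := by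
    rw [show l + (-(fun j => ((h j : ℕ) : ℤ)) + fun j => ((k j : ℕ) : ℤ)) =
      (l + fun j => ((k j : ℕ) : ℤ)) - fun j => ((h j : ℕ) : ℤ) by abel, sub_eq_zero]
  rw [if_congr hiff rfl rfl]
  split_ifs with hl
  · rw [boxCharacter, ← hl, character_add, boxCharacter, mul_one, mul_assoc,
      Complex.mul_conj', norm_character]
    simp
  · simp

/-- Fejér means of an integrable function converge to it in `L¹`. -/
theorem tendsto_integral_norm_complexKernelMean_sub {g : (Fin m → ℝ) → ℂ}
    (hg : Integrable g (cubeMeasure m)) :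
    Tendsto (fun d : Fin m → ℕ =>
      ∫ θ, ‖complexKernelMean (cubeMeasure m) (boxCharacter d) g θ - g θ‖ ∂cubeMeasure m)
      atTop (nhds 0) := by
  have hm := measurable_boxCharacter (m := m)
  have hn := norm_boxCharacter (m := m)
  have hspan : ∀ p ∈ Submodule.span ℂ (Set.range (character (m := m))),
      Integrable p (cubeMeasure m) ∧ Tendsto (fun d : Fin m → ℕ =>
        ∫ θ, ‖complexKernelMean (cubeMeasure m) (boxCharacter d) p θ - p θ‖ ∂cubeMeasure m)
        atTop (nhds 0) := by
    intro p hp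
    induction hp using Submodule.span_induction with
    | mem p hp =>
      obtain ⟨l, rfl⟩ := hp
      refine ⟨integrable_character l, ?_⟩
      have h : ∀ (d : Fin m → ℕ) (θ : Fin m → ℝ),
          ‖complexKernelMean (cubeMeasure m) (boxCharacter d) (character l) θ - character l θ‖ =
            |fejerMultiplier l d - 1| := fun d θ => by
        rw [complexKernelMean_character, ← sub_one_mul, norm_mul, norm_character, mul_one]
        exact_mod_cast Complex.norm_real _
      simp_rw [h, integral_const, probReal_univ, one_smul]
      simpa using ((tendsto_fejerMultiplier l).sub_const 1).abs
    | zero =>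
      refine ⟨integrable_zero _ _ _, ?_⟩
      simp [complexKernelMean]
    | add p₁ p₂ _ _ h₁ h₂ =>
      refine ⟨h₁.1.add h₂.1, squeeze_zero (fun d => integral_nonneg fun θ => norm_nonneg _)
        (fun d => ?_) (by simpa using h₁.2.add h₂.2)⟩
      have i₁ := (integrable_complexKernelMean (hm d) (hn d) h₁.1).sub h₁.1
      have i₂ := (integrable_complexKernelMean (hm d) (hn d) h₂.1).sub h₂.1
      have i₃ := (integrable_complexKernelMean (hm d) (hn d) (h₁.1.add h₂.1)).sub (h₁.1.add h₂.1)
      refine (integral_mono i₃.norm (i₁.norm.add i₂.norm) fun θ => ?_).trans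
        (integral_add i₁.norm i₂.norm).le
      have h := complexKernelMean_add (hm d) (hn d) h₁.1 h₂.1 θ
      change ‖complexKernelMean _ _ (fun x => p₁ x + p₂ x) θ - (p₁ θ + p₂ θ)‖ ≤ _
      rw [h, add_sub_add_comm]
      exact norm_add_le _ _
    | smul c p _ h =>
      refine ⟨h.1.smul c, ?_⟩
      have h' : ∀ (d : Fin m → ℕ) (θ : Fin m → ℝ),
          ‖complexKernelMean (cubeMeasure m) (boxCharacter d) (c • p) θ - (c • p) θ‖ =
            ‖c‖ * ‖complexKernelMean (cubeMeasure m) (boxCharacter d) p θ - p θ‖ := fun d θ => by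
        change ‖complexKernelMean _ _ (fun x => c * p x) θ - c * p θ‖ = _
        rw [complexKernelMean_const_mul, ← mul_sub, norm_mul]
      simp_rw [h', integral_const_mul]
      simpa using h.2.const_mul ‖c‖
  rw [Metric.tendsto_nhds]
  intro ε hε
  obtain ⟨p, hp, hgp⟩ := exists_span_character_near hg (show 0 < ε / 4 by positivity)
  obtain ⟨hpi, hpt⟩ := hspan p hp
  filter_upwards [Metric.tendsto_nhds.1 hpt (ε / 4) (by positivity), eventually_nonempty_box]
    with d hd hne
  rw [Real.dist_eq, sub_zero] at hd ⊢
  have hd := (le_abs_self _).trans_lt hd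
  rw [abs_of_nonneg (integral_nonneg fun θ => norm_nonneg _)]
  set A := complexKernelMean (cubeMeasure m) (boxCharacter d) with hA
  have igp : Integrable (fun x => g x + (-1) * p x) (cubeMeasure m) := hg.add (hpi.const_mul _)
  have iA := integrable_complexKernelMean (hm d) (hn d) hpi
  have iAg := integrable_complexKernelMean (hm d) (hn d) hg
  have iAgp := integrable_complexKernelMean (hm d) (hn d) igp
  have hcontr := integral_norm_complexKernelMean_le (hm d) (hn d)
    (integral_conj_boxCharacter_mul d) igp
  have hneg : ∀ x, ‖g x + (-1) * p x‖ = ‖g x - p x‖ := fun x => by congr 1; ring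
  simp_rw [hneg] at hcontr
  have hpt : ∀ θ, ‖A g θ - g θ‖ ≤
      ‖A (fun x => g x + (-1) * p x) θ‖ + (‖A p θ - p θ‖ + ‖g θ - p θ‖) := fun θ => by
    have h : A g θ - g θ =
        A (fun x => g x + (-1) * p x) θ + ((A p θ - p θ) + -(g θ - p θ)) := by
      rw [hA, complexKernelMean_add (hm d) (hn d) hg (hpi.const_mul _),
        complexKernelMean_const_mul]
      ring
    rw [h]
    refine (norm_add_le _ _).trans ?_
    gcongr
    refine (norm_add_le _ _).trans ?_
    rw [norm_neg]
  calc ∫ θ, ‖A g θ - g θ‖ ∂cubeMeasure m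
      ≤ ∫ θ, (‖A (fun x => g x + (-1) * p x) θ‖ + (‖A p θ - p θ‖ + ‖g θ - p θ‖))
          ∂cubeMeasure m :=
        integral_mono (iAg.sub hg).norm
          (iAgp.norm.add ((iA.sub hpi).norm.add (hg.sub hpi).norm)) hpt
    _ = (∫ θ, ‖A (fun x => g x + (-1) * p x) θ‖ ∂cubeMeasure m) +
          ((∫ θ, ‖A p θ - p θ‖ ∂cubeMeasure m) + ∫ θ, ‖g θ - p θ‖ ∂cubeMeasure m) := by
        have h1 := integral_add iAgp.norm ((iA.sub hpi).norm.add (hg.sub hpi).norm)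
        have h2 := integral_add (iA.sub hpi).norm (hg.sub hpi).norm
        simp only [Pi.add_apply, Pi.sub_apply] at h1 h2
        rw [h1, h2]
    _ < ε := by linarith

end Fejer

/-! ### The Szegő limit theorem -/

section Szego

open scoped ComplexConjugate

variable {m : ℕ}

lemma exp_neg_mul_tangent (n s t : ℝ) :
    Real.exp (-(n * s)) + -(n * Real.exp (-(n * s))) * (t - s) ≤ Real.exp (-(n * t)) := by
  have h := Real.add_one_le_exp (-(n * (t - s)))
  have h2 : Real.exp (-(n * t)) = Real.exp (-(n * s)) * Real.exp (-(n * (t - s))) := by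
    rw [← Real.exp_add]; ring_nf
  rw [h2]
  nlinarith [mul_le_mul_of_nonneg_left h (Real.exp_pos (-(n * s))).le]

lemma rpow_tangent {α : ℝ} (hα : 1 ≤ α) {s t : ℝ} (hs : 0 ≤ s) (ht : 0 ≤ t) :
    s ^ α + α * s ^ α / s * (t - s) ≤ t ^ α := by
  rcases hs.eq_or_lt with rfl | hs
  · simp only [Real.zero_rpow (by linarith : α ≠ 0), mul_zero, div_zero, zero_mul, add_zero]
    positivity
  · have h := one_add_mul_self_le_rpow_one_add (s := t / s - 1)
      (by linarith [div_nonneg ht hs.le]) hα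
    rw [add_sub_cancel, Real.div_rpow ht hs.le, le_div_iff₀ (by positivity)] at h
    refine le_of_eq_of_le ?_ h
    field_simp

variable {f : (Fin m → ℝ) → ℝ}
  {T : (d : Fin m → ℕ) → Matrix ((j : Fin m) → Fin (d j)) ((j : Fin m) → Fin (d j)) ℂ}

/-- Averages of `exp (-n λ)` over the eigenvalues of Toeplitz truncations converge. -/
theorem tendsto_familyAverage_exp (hT' : ∀ d, (T d).IsHermitian)
    (hf : Integrable f (cubeMeasure m)) (hfm : Measurable f) (hf0 : ∀ φ, 0 ≤ f φ)
    (hT : ∀ d h k, T d h k =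
      ∫ φ, (f φ : ℂ) * (conj (boxCharacter d h φ) * boxCharacter d k φ) ∂cubeMeasure m) (n : ℕ) :
    Tendsto (fun d => familyAverage (hT' d).eigenvalues fun x => Real.exp (-(n * x))) atTop
      (nhds (∫ φ, Real.exp (-(n * f φ)) ∂cubeMeasure m)) := by
  have hbd : ∀ g : (Fin m → ℝ) → ℝ, AEStronglyMeasurable g (cubeMeasure m) → (∀ φ, 0 ≤ g φ) →
      Integrable (fun φ => Real.exp (-(n * g φ))) (cubeMeasure m) := fun g hg hg0 =>
    Integrable.of_bound (C := 1)
      ((by fun_prop : Continuous fun x : ℝ => Real.exp (-(n * x))).comp_aestronglyMeasurable hg)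
      (ae_of_all _ fun φ => by
        rw [Real.norm_of_nonneg (Real.exp_pos _).le, Real.exp_le_one_iff]
        have := hg0 φ
        simp only [Left.neg_nonpos_iff]; positivity)
  have hker : ∀ d : Fin m → ℕ,
      Integrable (kernelMean (cubeMeasure m) (boxCharacter d) f) (cubeMeasure m) := fun d => by
    have h := (integrable_complexKernelMean (P := cubeMeasure m) (measurable_boxCharacter d)
      (norm_boxCharacter d) hf.ofReal).re
    refine h.congr (ae_of_all _ fun θ => ?_)
    have := complexKernelMean_ofReal (P := cubeMeasure m) (e := boxCharacter d) f θ
    simp only [RCLike.re_to_complex]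
    erw [this, Complex.ofReal_re]
  have hker0 : ∀ (d : Fin m → ℕ) θ, 0 ≤ kernelMean (cubeMeasure m) (boxCharacter d) f θ :=
    fun d θ => mul_nonneg (by positivity)
      (integral_nonneg fun x => mul_nonneg (hf0 x) (sqModulus_nonneg _ _))
  have hfej : Tendsto (fun d : Fin m → ℕ =>
      ∫ θ, |kernelMean (cubeMeasure m) (boxCharacter d) f θ - f θ| ∂cubeMeasure m)
      atTop (nhds 0) := by
    refine (tendsto_integral_norm_complexKernelMean_sub (m := m) hf.ofReal).congr fun d => ?_
    refine integral_congr_ae (ae_of_all _ fun θ => ?_)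
    have := complexKernelMean_ofReal (P := cubeMeasure m) (e := boxCharacter d) f θ
    simp only
    erw [this, ← Complex.ofReal_sub, Complex.norm_real, Real.norm_eq_abs]
    rfl
  have hlow := (tendsto_const_nhds
    (x := ∫ φ, Real.exp (-(n * f φ)) ∂cubeMeasure m)).sub (hfej.const_mul (n : ℝ))
  rw [mul_zero, sub_zero] at hlow
  refine tendsto_of_tendsto_of_tendsto_of_le_of_le' hlow tendsto_const_nhds ?_ ?_
  · filter_upwards [eventually_nonempty_box (m := m)] with d hd
    have := hd
    have habs : Integrable (fun θ => n *
        |kernelMean (cubeMeasure m) (boxCharacter d) f θ - f θ|) (cubeMeasure m) :=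
      ((hker d).sub hf).abs.const_mul _
    refine le_trans ?_ (le_familyAverage_eigenvalues (hT' d) (measurable_boxCharacter d)
      (norm_boxCharacter d) (integral_conj_boxCharacter_mul d) hf hf0 (hT d)
      (fun s t _ _ => exp_neg_mul_tangent n s t) (hbd _ (hker d).aestronglyMeasurable (hker0 d)))
    rw [← integral_const_mul, ← integral_sub (hbd f hfm.aestronglyMeasurable hf0) habs]
    refine integral_mono ((hbd f hfm.aestronglyMeasurable hf0).sub habs)
      (hbd _ (hker d).aestronglyMeasurable (hker0 d)) fun θ => ?_
    refine le_trans ?_ (exp_neg_mul_tangent n (f θ) _)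
    set u := kernelMean (cubeMeasure m) (boxCharacter d) f θ - f θ
    have h1 : Real.exp (-(n * f θ)) ≤ 1 := by
      rw [Real.exp_le_one_iff]
      have := hf0 θ
      simp only [Left.neg_nonpos_iff]; positivity
    have h2 : Real.exp (-(n * f θ)) * u ≤ |u| :=
      (mul_le_mul_of_nonneg_left (le_abs_self u) (Real.exp_pos _).le).trans
        (mul_le_of_le_one_left (abs_nonneg _) h1)
    have h3 := mul_le_mul_of_nonneg_left h2 (Nat.cast_nonneg (α := ℝ) n)
    simp only
    linarith
  · filter_upwards [eventually_nonempty_box (m := m)] with d hd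
    have := hd
    exact familyAverage_eigenvalues_le (hT' d) (measurable_boxCharacter d)
      (norm_boxCharacter d) (integral_conj_boxCharacter_mul d) hf hf0 (hT d)
      (fun s t _ _ => exp_neg_mul_tangent n s t) (hbd f hfm.aestronglyMeasurable hf0)

/-- The Szegő limit theorem for a symbol that is nonnegative everywhere and a test function
that is continuous on the whole line. -/
theorem tendsto_familyAverage_eigenvalues (hT' : ∀ d, (T d).IsHermitian)
    (hfm : Measurable f) (hf0 : ∀ φ, 0 ≤ f φ) {α : ℝ} (hα : 1 ≤ α)
    (hfα : Integrable (fun φ => f φ ^ α) (cubeMeasure m)) (hf : Integrable f (cubeMeasure m))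
    (hT : ∀ d h k, T d h k =
      ∫ φ, (f φ : ℂ) * (conj (boxCharacter d h φ) * boxCharacter d k φ) ∂cubeMeasure m)
    {F : ℝ → ℝ} (hF : Continuous F) {C M : ℝ} (hC : ∀ x, M ≤ x → |F x| ≤ C * x ^ α) :
    Tendsto (fun d => familyAverage (hT' d).eigenvalues F) atTop
      (nhds (∫ φ, F (f φ) ∂cubeMeasure m)) := by
  refine tendsto_familyAverage_of_growth hα hfm hf0 hfα
    (fun d i => eigenvalues_nonneg_of_symbol (hT' d) (measurable_boxCharacter d)
      (norm_boxCharacter d) hf hf0 (hT d) i)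
    (tendsto_familyAverage_exp hT' hf hfm hf0 hT) ?_ hF hC
  filter_upwards [eventually_nonempty_box (m := m)] with d hd
  have := hd
  exact familyAverage_eigenvalues_le (hT' d) (measurable_boxCharacter d)
    (norm_boxCharacter d) (integral_conj_boxCharacter_mul d) hf hf0 (hT d)
    (fun s t hs ht => rpow_tangent hα hs ht) hfα

end Szego

/-- multi-index Szegő-type theorem, nonnegative symbols: if
`a : [-π, π]ᵐ → ℝ≥0` is measurable with `∫ a^α d^m𝛗/(2π)^m < ∞` for some `α ≥ 1`, and
`F : ℝ≥0 → ℝ` is continuous with `F(x) = O(x^α)` as `x → ∞`, then for the Hermitian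
multi-index Toeplitz truncations `T⁽𝐝⁾` generated by the Fourier coefficients of `a`,
`(1/D(𝐝)) Σ_j F(λ_j(T⁽𝐝⁾)) → ∫ F(a(𝛗)) d^m𝛗/(2π)^m` as `min_j d_j → ∞`. -/
theorem multiindex_szego_theorem_nonneg_symbol
    (m : ℕ) (hm : 0 < m)
    (a : (Fin m → ℝ) → ℝ) (ha_meas : Measurable a)
    (ha_nonneg : ∀ φ ∈ Set.univ.pi fun _ : Fin m => Set.Icc (-π) π, 0 ≤ a φ)
    (α : ℝ) (hα : 1 ≤ α)
    (ha_int : IntegrableOn (fun φ => a φ ^ α) (Set.univ.pi fun _ : Fin m => Set.Icc (-π) π))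
    (F : ℝ → ℝ) (hF_cont : ContinuousOn F (Set.Ici 0))
    (hF_bigO : ∃ C M : ℝ, ∀ x : ℝ, M ≤ x → |F x| ≤ C * x ^ α)
    (T : (d : Fin m → ℕ) → Matrix ((j : Fin m) → Fin (d j)) ((j : Fin m) → Fin (d j)) ℂ)
    (hT : ∀ (d : Fin m → ℕ) (h k : (j : Fin m) → Fin (d j)),
      T d h k = (1 / (2 * π)) ^ m *
        ∫ φ in Set.univ.pi fun _ : Fin m => Set.Icc (-π) π,
          (a φ : ℂ) * Complex.exp (-Complex.I * ∑ j, (((h j : ℕ) : ℂ) - ((k j : ℕ) : ℂ)) * φ j))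
    (hH : ∀ d : Fin m → ℕ, (T d).IsHermitian) :
    Tendsto (fun d : Fin m → ℕ =>
        (1 / ((∏ j, d j : ℕ) : ℝ)) * ∑ i : (j : Fin m) → Fin (d j), F ((hH d).eigenvalues i))
      atTop
      (nhds ((1 / (2 * π)) ^ m *
        ∫ φ in Set.univ.pi fun _ : Fin m => Set.Icc (-π) π, F (a φ))) := by
  set f : (Fin m → ℝ) → ℝ := fun φ => max (a φ) 0 with hf_def
  set G : ℝ → ℝ := fun x => F (max x 0) with hG_def
  have hfa : ∀ φ ∈ piCube m, f φ = a φ := fun φ hφ => max_eq_left (ha_nonneg φ hφ)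
  have hfm : Measurable f := ha_meas.max measurable_const
  have hf0 : ∀ φ, 0 ≤ f φ := fun φ => le_max_right _ _
  have hfα : Integrable (fun φ => f φ ^ α) (cubeMeasure m) := by
    rw [integrable_cubeMeasure_iff]
    refine IntegrableOn.congr_fun ha_int (fun φ hφ => ?_) measurableSet_piCube
    simp only [hfa φ hφ]
  have hf : Integrable f (cubeMeasure m) := by
    refine Integrable.mono' ((integrable_const (1 : ℝ)).add hfα) hfm.aestronglyMeasurable
      (ae_of_all _ fun φ => ?_)
    rw [Real.norm_of_nonneg (hf0 φ)]
    have h0 : 0 ≤ f φ ^ α := Real.rpow_nonneg (hf0 φ) α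
    simp only [Pi.add_apply]
    rcases le_total (f φ) 1 with h | h
    · linarith
    · linarith [Real.self_le_rpow_of_one_le h hα]
  have hT2 : ∀ d h k, T d h k =
      ∫ φ, (f φ : ℂ) * (starRingEnd ℂ (boxCharacter d h φ) * boxCharacter d k φ)
        ∂cubeMeasure m := by
    intro d h k
    rw [hT, integral_cubeMeasure, Complex.real_smul]
    push_cast
    congr 1
    refine setIntegral_congr_fun measurableSet_piCube fun φ hφ => ?_
    simp only [hfa φ hφ, boxCharacter, conj_character, ← character_add]
    congr 1
    rw [character]
    congr 1
    rw [neg_mul, ← mul_neg, ← Finset.sum_neg_distrib]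
    congr 1
    refine Finset.sum_congr rfl fun j _ => ?_
    simp only [Pi.add_apply, Pi.neg_apply]
    push_cast
    ring
  have hGc : Continuous G :=
    hF_cont.comp_continuous (continuous_id.max continuous_const) fun x =>
    Set.mem_Ici.2 (le_max_right _ _)
  obtain ⟨C, M, hCM⟩ := hF_bigO
  have hGC : ∀ x, max M 0 ≤ x → |G x| ≤ C * x ^ α := fun x hx => by
    rw [hG_def]
    simp only [max_eq_left ((le_max_right M 0).trans hx)]
    exact hCM x ((le_max_left M 0).trans hx)
  have key := tendsto_familyAverage_eigenvalues hH hfm hf0 hα hfα hf hT2 hGc hGC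
  have hlim : ∫ φ, G (f φ) ∂cubeMeasure m =
      (1 / (2 * π)) ^ m * ∫ φ in piCube m, F (a φ) := by
    rw [integral_cubeMeasure, smul_eq_mul]
    congr 1
    refine setIntegral_congr_fun measurableSet_piCube fun φ hφ => ?_
    simp only [hG_def, hfa φ hφ, max_eq_left (ha_nonneg φ hφ)]
  rw [hlim] at key
  refine key.congr fun d => ?_
  rw [familyAverage, Fintype.card_pi]
  simp only [Fintype.card_fin]
  congr 1
  refine Finset.sum_congr rfl fun i _ => ?_
  rw [hG_def]
  simp only [max_eq_left (eigenvalues_nonneg_of_symbol (hH d) (measurable_boxCharacter d)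
    (norm_boxCharacter d) hf hf0 (hT2 d) i)]
end
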